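/- arXiv:1210.5865 — 7 statements merged into one kernel-verified Lean document; each statement's English description precedes it below -/
import Mathlib

section
/- Assume (T, d) is a geodesic space. Then the glued space is a length space, in the following chain form: for every x, y ∈ T and every ε > 0 there exist k ≥ 1 and points z_0, z_1, …, z_k ∈ T with z_0 = x and z_k = y such that Σ_{i=1}^k D(z_{i−1}, z_i) ≤ D(x,y) + ε and D(z_{i−1}, z_i) ≤ ε for each i = 1, …, k. -/
/-- The base relation for gluing: `x` is related to `y` iff `(x, y) = (u i, v i)` for some `i`. -/
def glueBase {T : Type*} {J : ℕ} (u v : Fin J → T) : T → T → Prop :=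
  fun x y => ∃ i : Fin J, x = u i ∧ y = v i

/-- The smallest equivalence relation on `T` identifying `u i` with `v i` for each `i`. -/
def glueEquiv {T : Type*} {J : ℕ} (u v : Fin J → T) : T → T → Prop :=
  Relation.EqvGen (glueBase u v)

/-- The glued (quotient) distance: the infimum over all chains
`x = x₁, y₁ ∼ x₂, y₂ ∼ x₃, …, y_k = y` of `∑ d(xᵢ, yᵢ)`. -/
noncomputable def glueDist {T : Type*} [MetricSpace T] {J : ℕ} (u v : Fin J → T)
    (x y : T) : ℝ :=
  sInf { s : ℝ | ∃ (k : ℕ) (xs ys : Fin (k + 1) → T),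
    xs 0 = x ∧ ys (Fin.last k) = y ∧
    (∀ i : Fin k, glueEquiv u v (ys i.castSucc) (xs i.succ)) ∧
    s = ∑ i, dist (xs i) (ys i) }

/-- The set `W` of glued points. -/
def glueSet {T : Type*} {J : ℕ} (u v : Fin J → T) : Set T :=
  Set.range u ∪ Set.range v


/-- `FineChain D ε a b s`: there is a nonempty chain of steps from `a` to `b`, each of `D`-length
at most `ε`, whose total `D`-length is `s`. -/
inductive FineChain {T : Type*} (D : T → T → ℝ) (ε : ℝ) : T → T → ℝ → Prop
  | single {a b : T} : D a b ≤ ε → FineChain D ε a b (D a b)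
  | cons {a b c : T} {s : ℝ} : D a b ≤ ε → FineChain D ε b c s → FineChain D ε a c (D a b + s)

theorem FineChain.trans {T : Type*} {D : T → T → ℝ} {ε : ℝ} {a b c : T} {s t : ℝ}
    (h : FineChain D ε a b s) (h' : FineChain D ε b c t) : FineChain D ε a c (s + t) := by
  induction h with
  | single hab => exact .cons hab h'
  | cons hab _ ih => rw [add_assoc]; exact .cons hab (ih h')

theorem FineChain.exists_fin {T : Type*} {D : T → T → ℝ} {ε : ℝ} {a b : T} {s : ℝ}
    (h : FineChain D ε a b s) :
    ∃ k : ℕ, 1 ≤ k ∧ ∃ z : Fin (k + 1) → T, z 0 = a ∧ z (Fin.last k) = b ∧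
      ∑ i : Fin k, D (z i.castSucc) (z i.succ) = s ∧
      ∀ i : Fin k, D (z i.castSucc) (z i.succ) ≤ ε := by
  induction h with
  | @single a b hab =>
    exact ⟨1, le_rfl, ![a, b], rfl, rfl, by simp, by simpa using hab⟩
  | @cons a b c s hab _ ih =>
    obtain ⟨k, -, z, rfl, rfl, rfl, hz⟩ := ih
    refine ⟨k + 1, by omega, Fin.cons a z, rfl, ?_, ?_, ?_⟩
    · rw [← Fin.succ_last, Fin.cons_succ]
    · simp [Fin.sum_univ_succ (n := k), Fin.castSucc_succ]
    · refine Fin.cases (by simpa using hab) fun i => ?_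
      simpa [Fin.castSucc_succ] using hz i

theorem glueDist_le_sum {T : Type*} [MetricSpace T] {J : ℕ} (u v : Fin J → T) {k : ℕ}
    (xs ys : Fin (k + 1) → T)
    (h : ∀ i : Fin k, glueEquiv u v (ys i.castSucc) (xs i.succ)) :
    glueDist u v (xs 0) (ys (Fin.last k)) ≤ ∑ i, dist (xs i) (ys i) := by
  refine csInf_le ⟨0, ?_⟩ ⟨k, xs, ys, rfl, rfl, h, rfl⟩
  rintro s ⟨k, xs, ys, -, -, -, rfl⟩
  positivity

theorem glueDist_le_dist {T : Type*} [MetricSpace T] {J : ℕ} (u v : Fin J → T) (x y : T) :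
    glueDist u v x y ≤ dist x y := by
  simpa using glueDist_le_sum u v (k := 0) (fun _ => x) (fun _ => y) (fun i => i.elim0)

theorem glueDist_le_zero_of_glueEquiv {T : Type*} [MetricSpace T] {J : ℕ} {u v : Fin J → T}
    {x y : T} (h : glueEquiv u v x y) : glueDist u v x y ≤ 0 := by
  simpa using glueDist_le_sum u v (k := 1) ![x, y] ![x, y] (by simpa using h)

/-- Cutting a sequence `g 0, …, g (n + 1)` into its steps gives a fine chain. -/
theorem fineChain_of_steps {T : Type*} {D : T → T → ℝ} {ε : ℝ} (g : ℕ → T) (n : ℕ) {c : ℝ}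
    (hc : c ≤ ε) (hg : ∀ i ≤ n, D (g i) (g (i + 1)) ≤ c) :
    ∃ s ≤ (n + 1) * c, FineChain D ε (g 0) (g (n + 1)) s := by
  induction n with
  | zero => exact ⟨_, by simpa using hg 0 le_rfl, .single ((hg 0 le_rfl).trans hc)⟩
  | succ n ih =>
    obtain ⟨s, hs, h⟩ := ih fun i hi => hg i (by omega)
    have hn := hg (n + 1) le_rfl
    refine ⟨_, ?_, h.trans (.single (hn.trans hc))⟩
    push_cast
    linarith

theorem exists_fineChain_le_dist {T : Type*} [MetricSpace T] {D : T → T → ℝ}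
    (hD : ∀ a b, D a b ≤ dist a b) {p q : T}
    (hgeo : ∃ γ : ℝ → T, γ 0 = p ∧ γ 1 = q ∧
      ∀ s ∈ Set.Icc (0 : ℝ) 1, ∀ t ∈ Set.Icc (0 : ℝ) 1,
        dist (γ s) (γ t) = |s - t| * dist p q)
    {ε : ℝ} (hε : 0 < ε) : ∃ s ≤ dist p q, FineChain D ε p q s := by
  obtain ⟨γ, h0, h1, hγ⟩ := hgeo
  obtain ⟨n, hn⟩ := exists_nat_ge (dist p q / ε)
  have hpos : (0 : ℝ) < n + 1 := by positivity
  have hc : dist p q / (n + 1) ≤ ε := by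
    rw [div_le_iff₀ hε] at hn
    rw [div_le_iff₀ hpos]
    linarith
  have hstep : ∀ i ≤ n, D (γ ((i : ℕ) / (n + 1))) (γ ((i + 1 : ℕ) / (n + 1))) ≤
      dist p q / (n + 1) := by
    intro i hi
    have hi' : (i : ℝ) ≤ n := by exact_mod_cast hi
    refine (hD _ _).trans_eq ?_
    rw [hγ _ ⟨by positivity, by rw [div_le_one hpos]; linarith⟩ _
      ⟨by positivity, by rw [div_le_one hpos]; push_cast; linarith⟩, ← sub_div, abs_div,
      abs_of_pos hpos]
    simp [div_eq_inv_mul]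
  obtain ⟨s, hs, h⟩ := fineChain_of_steps (fun i : ℕ => γ (i / (n + 1))) n hc hstep
  refine ⟨s, hs.trans_eq (by field_simp), ?_⟩
  have hlast : (((n + 1 : ℕ) : ℝ) / (n + 1)) = 1 := by push_cast; field_simp
  simpa only [hlast, Nat.cast_zero, zero_div, h0, h1] using h

theorem exists_fineChain_le_sum {T : Type*} [MetricSpace T] {J : ℕ} (u v : Fin J → T)
    (hgeo : ∀ p q : T, ∃ γ : ℝ → T, γ 0 = p ∧ γ 1 = q ∧
      ∀ s ∈ Set.Icc (0 : ℝ) 1, ∀ t ∈ Set.Icc (0 : ℝ) 1,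
        dist (γ s) (γ t) = |s - t| * dist p q)
    {ε : ℝ} (hε : 0 < ε) (k : ℕ) (xs ys : Fin (k + 1) → T)
    (h : ∀ i : Fin k, glueEquiv u v (ys i.castSucc) (xs i.succ)) :
    ∃ s ≤ ∑ i, dist (xs i) (ys i),
      FineChain (glueDist u v) ε (xs 0) (ys (Fin.last k)) s := by
  have hd := fun p q => exists_fineChain_le_dist (glueDist_le_dist u v) (hgeo p q) hε
  induction k with
  | zero => simpa using hd (xs 0) (ys 0)
  | succ k ih =>
    obtain ⟨s, hs, hchain⟩ := ih (fun i => xs i.castSucc) (fun i => ys i.castSucc)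
      fun i => h i.castSucc
    obtain ⟨t, ht, htail⟩ := hd (xs (Fin.last (k + 1))) (ys (Fin.last (k + 1)))
    have hglue := glueDist_le_zero_of_glueEquiv (h (Fin.last k))
    refine ⟨_, ?_, hchain.trans (.cons (hglue.trans hε.le) htail)⟩
    rw [Fin.sum_univ_castSucc]
    simp only [Fin.succ_last] at hglue ⊢
    linarith

/-- If `(T, d)` is a geodesic space, then the glued space is a length space, in chain form:
for every `x, y` and `ε > 0` there is a chain `x = z₀, z₁, …, z_k = y` with
`∑ D(z_{i-1}, z_i) ≤ D(x,y) + ε` and each step of `D`-length at most `ε`. -/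
theorem glueDist_lengthSpace {T : Type*} [MetricSpace T] {J : ℕ} (u v : Fin J → T)
    (hgeo : ∀ p q : T, ∃ γ : ℝ → T, γ 0 = p ∧ γ 1 = q ∧
      ∀ s ∈ Set.Icc (0 : ℝ) 1, ∀ t ∈ Set.Icc (0 : ℝ) 1,
        dist (γ s) (γ t) = |s - t| * dist p q) :
    ∀ x y : T, ∀ ε : ℝ, 0 < ε →
      ∃ k : ℕ, 1 ≤ k ∧ ∃ z : Fin (k + 1) → T, z 0 = x ∧ z (Fin.last k) = y ∧
        (∑ i : Fin k, glueDist u v (z i.castSucc) (z i.succ)) ≤ glueDist u v x y + ε ∧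
        ∀ i : Fin k, glueDist u v (z i.castSucc) (z i.succ) ≤ ε := by
  intro x y ε hε
  have hlt : glueDist u v x y < glueDist u v x y + ε := lt_add_of_pos_right _ hε
  obtain ⟨_, ⟨k, xs, ys, rfl, rfl, h, rfl⟩, hlt⟩ := exists_lt_of_csInf_lt (by
    exact ⟨dist x y, 0, fun _ => x, fun _ => y, rfl, rfl, fun i => i.elim0, by simp⟩) hlt
  obtain ⟨s, hs, hchain⟩ := exists_fineChain_le_sum u v hgeo hε k xs ys h
  obtain ⟨n, hn, z, hz0, hzn, hsum, hz⟩ := hchain.exists_fin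
  exact ⟨n, hn, z, hz0, hzn, hsum.trans_le (hs.trans hlt.le), hz⟩
end

section
/- Assume (T, d) is a geodesic space. Then D satisfies the chaining condition with constant 2: for every x, y ∈ T and every integer n ≥ 1 there exist points z_0, z_1, …, z_n ∈ T with z_0 = x and z_n = y such that D(z_{i−1}, z_i) ≤ 2 D(x,y)/n for every i = 1, …, n. -/
/-- `GlueChain u v x y s` says that `s` is the length of some chain from `x` to `y` whose jumps
are along `glueEquiv u v`. -/
inductive GlueChain {T : Type*} [MetricSpace T] {J : ℕ} (u v : Fin J → T) : T → T → ℝ → Prop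
  | single (x y : T) : GlueChain u v x y (dist x y)
  | cons (x : T) {y x' z : T} {s : ℝ} (h : glueEquiv u v y x') (hc : GlueChain u v x' z s) :
      GlueChain u v x z (dist x y + s)

namespace GlueChain

variable {T : Type*} [MetricSpace T] {J : ℕ} {u v : Fin J → T}

lemma nonneg {x y : T} {s : ℝ} (h : GlueChain u v x y s) : 0 ≤ s := by
  induction h with
  | single x y => exact dist_nonneg
  | cons x h hc ih => exact add_nonneg dist_nonneg ih

lemma of_fin {y : T} (k : ℕ) (xs ys : Fin (k + 1) → T) (hy : ys (Fin.last k) = y)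
    (h : ∀ i : Fin k, glueEquiv u v (ys i.castSucc) (xs i.succ)) :
    GlueChain u v (xs 0) y (∑ i, dist (xs i) (ys i)) := by
  induction k with
  | zero =>
    subst hy
    simpa using single (u := u) (v := v) (xs 0) (ys 0)
  | succ k ih =>
    rw [Fin.sum_univ_succ]
    exact cons _ (h 0) (ih (fun i => xs i.succ) (fun i => ys i.succ) hy fun i => h i.succ)

lemma exists_fin {x y : T} {s : ℝ} (h : GlueChain u v x y s) :
    ∃ (k : ℕ) (xs ys : Fin (k + 1) → T), xs 0 = x ∧ ys (Fin.last k) = y ∧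
      (∀ i : Fin k, glueEquiv u v (ys i.castSucc) (xs i.succ)) ∧
      s = ∑ i, dist (xs i) (ys i) := by
  induction h with
  | single x y => exact ⟨0, fun _ => x, fun _ => y, rfl, rfl, fun i => i.elim0, by simp⟩
  | @cons x y x' z s h hc ih =>
    obtain ⟨k, xs, ys, hx, hy, hr, hs⟩ := ih
    refine ⟨k + 1, Fin.cons x xs, Fin.cons y ys, rfl, ?_, fun i => ?_, ?_⟩
    · rw [← Fin.succ_last, Fin.cons_succ, hy]
    · cases i using Fin.cases with
      | zero => simpa [hx] using h
      | succ i => simpa [← Fin.succ_castSucc] using hr i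
    · rw [Fin.sum_univ_succ, hs]
      simp

end GlueChain

section

variable {T : Type*} [MetricSpace T] {J : ℕ} {u v : Fin J → T}

lemma glueDist_eq_sInf_glueChain (x y : T) :
    glueDist u v x y = sInf {s : ℝ | GlueChain u v x y s} := by
  unfold glueDist
  congr 1
  ext s
  constructor
  · rintro ⟨k, xs, ys, rfl, hy, h, rfl⟩
    exact GlueChain.of_fin k xs ys hy h
  · exact GlueChain.exists_fin

lemma glueDist_nonneg (x y : T) : 0 ≤ glueDist u v x y := by
  rw [glueDist_eq_sInf_glueChain]
  exact Real.sInf_nonneg fun _ hs => GlueChain.nonneg hs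

lemma GlueChain.glueDist_le {x y : T} {s : ℝ} (h : GlueChain u v x y s) :
    glueDist u v x y ≤ s := by
  rw [glueDist_eq_sInf_glueChain]
  exact csInf_le ⟨0, fun _ hs => GlueChain.nonneg hs⟩ h

lemma glueDist_self (x : T) : glueDist u v x x = 0 :=
  le_antisymm (by simpa using (GlueChain.single (u := u) (v := v) x x).glueDist_le)
    (glueDist_nonneg x x)

lemma exists_glueChain_lt {x y : T} {c : ℝ} (h : glueDist u v x y < c) :
    ∃ s < c, GlueChain u v x y s := by
  rw [glueDist_eq_sInf_glueChain] at h
  obtain ⟨s, hs, hsc⟩ := exists_lt_of_csInf_lt ⟨_, GlueChain.single x y⟩ h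
  exact ⟨s, hsc, hs⟩

lemma exists_dist_eq_of_geodesic {p q : T}
    (hgeo : ∃ γ : ℝ → T, γ 0 = p ∧ γ 1 = q ∧
      ∀ s ∈ Set.Icc (0 : ℝ) 1, ∀ t ∈ Set.Icc (0 : ℝ) 1,
        dist (γ s) (γ t) = |s - t| * dist p q)
    {t : ℝ} (ht : 0 ≤ t) (htd : t ≤ dist p q) :
    ∃ z, dist p z = t ∧ dist z q = dist p q - t := by
  obtain ⟨γ, h0, h1, h⟩ := hgeo
  rcases (dist_nonneg (x := p) (y := q)).eq_or_lt with hd | hd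
  · have ht0 : t = 0 := by linarith
    exact ⟨p, by simp [ht0], by simp [ht0]⟩
  · have hm : t / dist p q ∈ Set.Icc (0 : ℝ) 1 := ⟨by positivity, (div_le_one hd).2 htd⟩
    refine ⟨γ (t / dist p q), ?_, ?_⟩
    · nth_rewrite 1 [← h0]
      rw [h 0 (by simp) _ hm, zero_sub, abs_neg, abs_of_nonneg hm.1]
      field_simp
    · nth_rewrite 2 [← h1]
      rw [h _ hm 1 (by simp), abs_sub_comm, abs_of_nonneg (sub_nonneg.2 hm.2)]
      field_simp

/-- In a geodesic space a chain can be cut at any prescribed length. -/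
lemma GlueChain.exists_split
    (hgeo : ∀ p q : T, ∃ γ : ℝ → T, γ 0 = p ∧ γ 1 = q ∧
      ∀ s ∈ Set.Icc (0 : ℝ) 1, ∀ t ∈ Set.Icc (0 : ℝ) 1,
        dist (γ s) (γ t) = |s - t| * dist p q)
    {x y : T} {s t : ℝ} (h : GlueChain u v x y s) (ht : 0 ≤ t)
    (hts : t ≤ s) : ∃ z, GlueChain u v x z t ∧ GlueChain u v z y (s - t) := by
  induction h generalizing t with
  | single x y =>
    obtain ⟨z, hz, hz'⟩ := exists_dist_eq_of_geodesic (hgeo x y) ht hts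
    exact ⟨z, hz ▸ single x z, hz' ▸ single z y⟩
  | @cons x y x' w s h hc ih =>
    rcases le_total t (dist x y) with htd | htd
    · obtain ⟨z, hz, hz'⟩ := exists_dist_eq_of_geodesic (hgeo x y) ht htd
      refine ⟨z, hz ▸ single x z, ?_⟩
      convert cons z h hc using 1
      linarith
    · obtain ⟨z, hz, hz'⟩ := ih (sub_nonneg.2 htd) (by linarith)
      refine ⟨z, ?_, ?_⟩
      · convert cons x h hz using 1
        ring
      · convert hz' using 1
        ring

/-- In a geodesic space a chain can be cut into `n` chains of equal length. -/
lemma GlueChain.exists_subdivision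
    (hgeo : ∀ p q : T, ∃ γ : ℝ → T, γ 0 = p ∧ γ 1 = q ∧
      ∀ s ∈ Set.Icc (0 : ℝ) 1, ∀ t ∈ Set.Icc (0 : ℝ) 1,
        dist (γ s) (γ t) = |s - t| * dist p q)
    {n : ℕ} (hn : 1 ≤ n) {x y : T} {c : ℝ} (hc : 0 ≤ c)
    (h : GlueChain u v x y (n * c)) :
    ∃ z : ℕ → T, z 0 = x ∧ z n = y ∧ ∀ i < n, GlueChain u v (z i) (z (i + 1)) c := by
  induction n, hn using Nat.le_induction generalizing x with
  | base =>
    refine ⟨fun i => if i = 0 then x else y, by simp, by simp, fun i hi => ?_⟩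
    obtain rfl : i = 0 := by omega
    simpa using h
  | succ n hn ih =>
    have hnc : 0 ≤ n * c := by positivity
    obtain ⟨w, hxw, hwy⟩ := h.exists_split hgeo hc (by push_cast; linarith)
    obtain ⟨z, hz0, hzn, hz⟩ := ih (x := w) (by convert hwy using 1; push_cast; ring)
    refine ⟨fun i => i.casesOn x z, rfl, hzn, fun i hi => ?_⟩
    cases i with
    | zero => simpa [hz0] using hxw
    | succ i => exact hz i (by omega)

end

/-- If `(T, d)` is a geodesic space, then the glued distance `D` satisfies the chaining
condition with constant `2`: for all `x, y` and `n ≥ 1` there are points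
`x = z₀, z₁, …, z_n = y` with `D(z_{i-1}, z_i) ≤ 2 D(x,y) / n` for each `i`. -/
theorem glueDist_chaining {T : Type*} [MetricSpace T] {J : ℕ} (u v : Fin J → T)
    (hgeo : ∀ p q : T, ∃ γ : ℝ → T, γ 0 = p ∧ γ 1 = q ∧
      ∀ s ∈ Set.Icc (0 : ℝ) 1, ∀ t ∈ Set.Icc (0 : ℝ) 1,
        dist (γ s) (γ t) = |s - t| * dist p q) :
    ∀ x y : T, ∀ n : ℕ, 1 ≤ n →
      ∃ z : Fin (n + 1) → T, z 0 = x ∧ z (Fin.last n) = y ∧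
        ∀ i : Fin n, glueDist u v (z i.castSucc) (z i.succ) ≤
          2 * glueDist u v x y / n := by
  intro x y n hn
  have hn0 : (0 : ℝ) < n := by exact_mod_cast hn
  rcases (glueDist_nonneg (u := u) (v := v) x y).eq_or_lt with hL | hL
  · refine ⟨fun i => if i = Fin.last n then y else x, ?_, by simp, fun i => ?_⟩
    · simp [Fin.ext_iff, show (0 : ℕ) ≠ n by omega]
    · have hi : i.castSucc ≠ Fin.last n := (Fin.castSucc_lt_last i).ne
      simp only [← hL, if_neg hi]
      split_ifs
      · simp [← hL]
      · simp [glueDist_self]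
  · obtain ⟨s, hs, hc⟩ := exists_glueChain_lt
      (show glueDist u v x y < 2 * glueDist u v x y by linarith)
    obtain ⟨z, hz0, hzn, hz⟩ := GlueChain.exists_subdivision hgeo hn
      (div_nonneg hc.nonneg hn0.le) (c := s / n) (by rwa [mul_div_cancel₀ _ hn0.ne'])
    refine ⟨fun i => z i, hz0, hzn, fun i => ?_⟩
    exact (hz i i.isLt).glueDist_le.trans (by gcongr)
end

section
/- There exists a constant c > 0, independent of L, p and of the kernel κ, such that for all such Markov chains and all real s, t > 0, P₀( ξ_{⌊ s L² ⌋} ≥ t L ) ≤ 2^{2+s} e^{−c p t}. -/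
open MeasureTheory Finset

/-- The number of visits to `0` made by the trajectory `ω` up to and including time `n`. -/
def visitsToZero (ω : ℕ → ℕ) (n : ℕ) : ℕ :=
  ((Finset.range (n + 1)).filter fun m => ω m = 0).card

/-- The number of visits to `0` up to time `n` depends only on the path up to time `n`. -/
lemma visitsToZero_congr {ω ω' : ℕ → ℕ} {n : ℕ} (h : ∀ i ≤ n, ω i = ω' i) :
    visitsToZero ω n = visitsToZero ω' n := by
  unfold visitsToZero
  congr 1
  apply Finset.filter_congr
  intro i hi
  rw [h i (Nat.lt_succ_iff.mp (Finset.mem_range.mp hi))]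

lemma visitsToZero_succ (ω : ℕ → ℕ) (n : ℕ) :
    visitsToZero ω (n + 1) = visitsToZero ω n + if ω (n + 1) = 0 then 1 else 0 := by
  unfold visitsToZero
  rw [Finset.range_add_one, Finset.filter_insert]
  split_ifs with h
  · rw [Finset.card_insert_of_notMem (by simp)]
  · simp

/-- Exponential tail bound for the number of visits to `0` during `k` further steps, given the
path up to time `m`, obtained from a Lyapunov function `g` for the tilted kernel. -/
lemma measure_cylinder_visitsToZero_le {N : ℕ} {κ : ℕ → ℕ → ℝ} {P : Measure (ℕ → ℕ)}
    (hκ0 : ∀ x ≤ N, ∀ y, 0 ≤ κ x y) (hκN : ∀ x ≤ N, ∀ y, N < y → κ x y = 0)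
    (hP : ∀ (n : ℕ) (tr : ℕ → ℕ), P { ω | ∀ i ≤ n, ω i = tr i } =
      if tr 0 = 0 then ∏ i ∈ Finset.range n, ENNReal.ofReal (κ (tr i) (tr (i + 1))) else 0)
    {a R v : ℝ} (ha : 0 ≤ a) (hR : 0 ≤ R) {g : ℕ → ℝ} (hg : ∀ x ≤ N, 1 ≤ g x)
    (hstep : ∀ x ≤ N, ∑ y ∈ Finset.range (N + 1),
      κ x y * (Real.exp (a * (if y = 0 then 1 else 0)) * g y) ≤ R * g x)
    (k m : ℕ) (tr : ℕ → ℕ) (htr : tr m ≤ N) :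
    P { ω | (∀ i ≤ m, ω i = tr i) ∧ v ≤ (visitsToZero ω (m + k) : ℝ) } ≤
      P { ω | ∀ i ≤ m, ω i = tr i } *
        ENNReal.ofReal (R ^ k * g (tr m) * Real.exp (a * (visitsToZero tr m - v))) := by
  induction k generalizing m tr with
  | zero =>
    by_cases hv : v ≤ (visitsToZero tr m : ℝ)
    · calc _ ≤ P { ω | ∀ i ≤ m, ω i = tr i } := measure_mono fun ω hω => hω.1
        _ = P { ω | ∀ i ≤ m, ω i = tr i } * 1 := (mul_one _).symm
        _ ≤ _ := by
          gcongr
          rw [ENNReal.one_le_ofReal, pow_zero, one_mul]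
          exact one_le_mul_of_one_le_of_one_le (hg _ htr)
            (Real.one_le_exp (mul_nonneg ha (sub_nonneg.2 hv)))
    · have : { ω | (∀ i ≤ m, ω i = tr i) ∧ v ≤ (visitsToZero ω (m + 0) : ℝ) } = ∅ := by
        ext ω
        simp only [Set.mem_ofPred_eq, Set.mem_empty_iff_false, iff_false, not_and]
        intro h
        rwa [add_zero, visitsToZero_congr h]
      rw [this, measure_empty]
      exact zero_le
  | succ k ih =>
    let ext : ℕ → ℕ → ℕ := fun y => Function.update tr (m + 1) y
    have hext : ∀ y, ∀ i ≤ m, ext y i = tr i := fun y i hi =>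
      Function.update_of_ne (by omega) _ _
    have hext' : ∀ y, ext y (m + 1) = y := fun y => Function.update_self _ _ _
    have hcyl : ∀ y, P { ω | ∀ i ≤ m + 1, ω i = ext y i } =
        P { ω | ∀ i ≤ m, ω i = tr i } * ENNReal.ofReal (κ (tr m) y) := by
      intro y
      rw [hP, hP, hext y 0 (Nat.zero_le _), Finset.prod_range_succ, hext', hext y m le_rfl]
      split_ifs
      · congr 1
        apply Finset.prod_congr rfl
        intro i hi
        have := Finset.mem_range.mp hi
        rw [hext y i (by omega), hext y (i + 1) (by omega)]
      · simp
    let A : ℕ → Set (ℕ → ℕ) := fun y =>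
      { ω | (∀ i ≤ m + 1, ω i = ext y i) ∧ v ≤ (visitsToZero ω (m + 1 + k) : ℝ) }
    have hsub : { ω | (∀ i ≤ m, ω i = tr i) ∧ v ≤ (visitsToZero ω (m + (k + 1)) : ℝ) } ⊆
        ⋃ y, A y := by
      rintro ω ⟨h1, h2⟩
      refine Set.mem_iUnion.2 ⟨ω (m + 1), fun i hi => ?_, ?_⟩
      · rcases Nat.le_succ_iff.mp hi with hi | rfl
        · rw [hext _ i hi, h1 i hi]
        · rw [hext']
      · rwa [add_assoc, add_comm 1 k]
    have hzero : ∀ y ∉ Finset.range (N + 1), P (A y) = 0 := by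
      intro y hy
      refine measure_mono_null (fun ω hω => hω.1) ((hcyl y).trans ?_)
      rw [hκN _ htr y (by simpa [Nat.lt_succ_iff] using hy)]
      simp
    set E := Real.exp (a * (visitsToZero tr m - v))
    have hbound : ∀ y ∈ Finset.range (N + 1), P (A y) ≤ P { ω | ∀ i ≤ m, ω i = tr i } *
        ENNReal.ofReal (R ^ k * E *
          (κ (tr m) y * (Real.exp (a * (if y = 0 then 1 else 0)) * g y))) := by
      intro y hy
      have h := ih (m + 1) (ext y)
        (by rw [hext']; exact Nat.lt_succ_iff.mp (Finset.mem_range.mp hy))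
      rw [hcyl, hext', mul_assoc, ← ENNReal.ofReal_mul (hκ0 _ htr y)] at h
      refine h.trans_eq ?_
      rw [visitsToZero_succ, hext', visitsToZero_congr (hext y)]
      congr 2
      have : a * (((visitsToZero tr m + if y = 0 then 1 else 0 : ℕ) : ℝ) - v) =
          a * (if y = 0 then 1 else 0) + a * (visitsToZero tr m - v) := by
        push_cast
        ring
      rw [this, Real.exp_add]
      ring
    have hterm : ∀ y ∈ Finset.range (N + 1), 0 ≤ R ^ k * E *
        (κ (tr m) y * (Real.exp (a * (if y = 0 then 1 else 0)) * g y)) := by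
      intro y hy
      have h1 := hκ0 _ htr y
      have h2 := hg y (Nat.lt_succ_iff.mp (Finset.mem_range.mp hy))
      positivity
    calc _ ≤ P (⋃ y, A y) := measure_mono hsub
      _ ≤ ∑' y, P (A y) := measure_iUnion_le _
      _ = ∑ y ∈ Finset.range (N + 1), P (A y) := tsum_eq_sum hzero
      _ ≤ _ := Finset.sum_le_sum hbound
      _ = P { ω | ∀ i ≤ m, ω i = tr i } * ENNReal.ofReal (R ^ k * E *
          ∑ y ∈ Finset.range (N + 1),
            κ (tr m) y * (Real.exp (a * (if y = 0 then 1 else 0)) * g y)) := by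
        rw [← Finset.mul_sum, ← ENNReal.ofReal_sum_of_nonneg hterm, ← Finset.mul_sum]
      _ ≤ _ := by
        gcongr _ * ENNReal.ofReal ?_
        calc _ ≤ R ^ k * E * (R * g (tr m)) := by
              gcongr
              exact hstep _ htr
          _ = _ := by ring

/-- A parabola on `{0, …, 2L}` with minimum `1` at `L` and maximum `3/2` at the endpoints. -/
noncomputable def parabola (L : ℕ) (x : ℕ) : ℝ := 1 + ((x : ℝ) - L) ^ 2 / (2 * (L : ℝ) ^ 2)

lemma one_le_parabola (L x : ℕ) : 1 ≤ parabola L x := by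
  unfold parabola
  have : 0 ≤ ((x : ℝ) - L) ^ 2 / (2 * (L : ℝ) ^ 2) := by positivity
  linarith

lemma parabola_zero {L : ℕ} (hL : 1 ≤ L) : parabola L 0 = 3 / 2 := by
  unfold parabola
  have : (0 : ℝ) < L := by exact_mod_cast hL
  push_cast
  field_simp
  ring

lemma parabola_two_mul {L : ℕ} (hL : 1 ≤ L) : parabola L (2 * L) = 3 / 2 := by
  unfold parabola
  have : (0 : ℝ) < L := by exact_mod_cast hL
  push_cast
  field_simp
  ring

lemma parabola_le {L x : ℕ} (hL : 1 ≤ L) (hx : x ≤ 2 * L) : parabola L x ≤ 3 / 2 := by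
  unfold parabola
  have : (0 : ℝ) < L := by exact_mod_cast hL
  have hx' : (x : ℝ) ≤ 2 * L := by exact_mod_cast hx
  have : ((x : ℝ) - L) ^ 2 / (2 * (L : ℝ) ^ 2) ≤ 1 / 2 := by
    rw [div_le_iff₀ (by positivity)]
    nlinarith [mul_nonneg (Nat.cast_nonneg (α := ℝ) x) (sub_nonneg.2 hx')]
  linarith

lemma parabola_one_le {L : ℕ} (hL : 1 ≤ L) : parabola L 1 ≤ 3 / 2 - 1 / (2 * L) := by
  unfold parabola
  have hL' : (1 : ℝ) ≤ L := by exact_mod_cast hL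
  have h : 1 / (2 * (L : ℝ)) = L / (2 * (L : ℝ) ^ 2) := by field_simp
  have : (((1 : ℕ) : ℝ) - L) ^ 2 / (2 * (L : ℝ) ^ 2) ≤ 1 / 2 - 1 / (2 * L) := by
    rw [h, div_le_iff₀ (by positivity), sub_mul, div_mul_cancel₀ _ (by positivity)]
    push_cast
    nlinarith
  linarith

lemma parabola_average {L x : ℕ} (hL : 1 ≤ L) (hx : 0 < x) :
    (parabola L (x - 1) + parabola L (x + 1)) / 2 = parabola L x + 1 / (2 * (L : ℝ) ^ 2) := by
  unfold parabola
  have : (0 : ℝ) < L := by exact_mod_cast hL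
  rw [Nat.cast_sub hx]
  push_cast
  field_simp
  ring

/-- Two atoms of mass `1 / 2` exhaust a probability vector. -/
lemma sum_mul_of_two_halves {N : ℕ} {q f : ℕ → ℝ} (hq : ∀ y, 0 ≤ q y)
    (hsum : ∑ y ∈ Finset.range (N + 1), q y = 1) {i j : ℕ} (hi : i ≤ N) (hj : j ≤ N)
    (hij : i ≠ j) (hqi : q i = 1 / 2) (hqj : q j = 1 / 2) :
    ∑ y ∈ Finset.range (N + 1), q y * f y = (f i + f j) / 2 := by
  have hsub : ({i, j} : Finset ℕ) ⊆ Finset.range (N + 1) := by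
    intro y hy
    simp only [Finset.mem_insert, Finset.mem_singleton] at hy
    rw [Finset.mem_range]
    omega
  have hpair : ∑ y ∈ ({i, j} : Finset ℕ), q y = 1 := by
    rw [Finset.sum_pair hij, hqi, hqj]
    norm_num
  have hzero : ∀ y ∈ Finset.range (N + 1) \ {i, j}, q y = 0 := by
    rw [← Finset.sum_eq_zero_iff_of_nonneg fun y _ => hq y]
    linarith [Finset.sum_sdiff (f := q) hsub]
  rw [← Finset.sum_subset hsub, Finset.sum_pair hij, hqi, hqj]
  · ring
  · intro y hy hy'
    rw [hzero y (Finset.mem_sdiff.2 ⟨hy, hy'⟩), zero_mul]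

/-- There is a constant `c > 0`, independent of `L`, `p` and of the kernel `κ`, such that for
any Markov chain on `{0, 1, …, 2L}` which behaves like simple random walk on the interior and
jumps from `0` to `1` with probability `p`, started at `0`, the number `ξ` of visits to `0`
satisfies `P₀(ξ_{⌊sL²⌋} ≥ tL) ≤ 2^{2+s} e^{-cpt}` for all `s, t > 0`. Here the law of the
chain is characterized by its cylinder probabilities. -/
theorem occupation_time_tail_bound :
    ∃ c : ℝ, 0 < c ∧
      ∀ (L : ℕ), 1 ≤ L → ∀ (p : ℝ), 0 < p → p ≤ 1 →
      ∀ κ : ℕ → ℕ → ℝ,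
        (∀ x, x ≤ 2 * L →
          (∀ y, 0 ≤ κ x y) ∧ (∀ y, 2 * L < y → κ x y = 0) ∧
            ∑ y ∈ Finset.range (2 * L + 1), κ x y = 1) →
        (∀ x, 0 < x → x < 2 * L → κ x (x - 1) = 1 / 2 ∧ κ x (x + 1) = 1 / 2) →
        κ 0 1 = p →
      ∀ P : Measure (ℕ → ℕ), IsProbabilityMeasure P →
        (∀ (n : ℕ) (tr : ℕ → ℕ),
          P { ω | ∀ i ≤ n, ω i = tr i } =
            if tr 0 = 0 then
              ∏ i ∈ Finset.range n, ENNReal.ofReal (κ (tr i) (tr (i + 1)))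
            else 0) →
      ∀ s t : ℝ, 0 < s → 0 < t →
        P { ω | t * L ≤ (visitsToZero ω ⌊s * (L : ℝ) ^ 2⌋₊ : ℝ) } ≤
          ENNReal.ofReal (2 ^ (2 + s) * Real.exp (-c * p * t)) := by
  refine ⟨1 / 3, by norm_num, ?_⟩
  intro L hL p hp0 hp1 κ hκ hint hκ01 P _ hP s t hs ht
  have hL' : (1 : ℝ) ≤ L := by exact_mod_cast hL
  have hLpos : (0 : ℝ) < L := by linarith
  set a : ℝ := p / (3 * L) with ha_def
  have ha : 0 ≤ a := by positivity
  have ha3 : a ≤ 1 / 3 := by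
    rw [ha_def, div_le_iff₀ (by positivity)]
    linarith
  set R : ℝ := 1 + 1 / (2 * (L : ℝ) ^ 2) with hR_def
  have hR1 : 1 ≤ R := by
    rw [hR_def]
    have : 0 ≤ 1 / (2 * (L : ℝ) ^ 2) := by positivity
    linarith
  let g : ℕ → ℝ := fun x => parabola L x * Real.exp (-(a * (if x = 0 then 1 else 0)))
  have hg0 : 3 / 2 * (1 - a) ≤ g 0 := by
    simp only [g, parabola_zero hL, if_true, mul_one]
    gcongr
    linarith [Real.add_one_le_exp (-a)]
  have hgx : ∀ x, x ≠ 0 → g x = parabola L x := by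
    intro x hx
    simp [g, hx]
  have hg : ∀ x ≤ 2 * L, 1 ≤ g x := by
    intro x _
    rcases eq_or_ne x 0 with rfl | hx
    · linarith
    · rw [hgx x hx]
      exact one_le_parabola L x
  have htilt : ∀ y, Real.exp (a * (if y = 0 then 1 else 0)) * g y = parabola L y := by
    intro y
    rw [mul_left_comm, ← Real.exp_add, add_neg_cancel, Real.exp_zero, mul_one]
  have hstep : ∀ x ≤ 2 * L, ∑ y ∈ Finset.range (2 * L + 1),
      κ x y * (Real.exp (a * (if y = 0 then 1 else 0)) * g y) ≤ R * g x := by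
    intro x hx
    simp only [htilt]
    obtain ⟨hnn, -, hsum⟩ := hκ x hx
    have hle : ∀ y ∈ Finset.range (2 * L + 1), κ x y * parabola L y ≤ κ x y * (3 / 2) :=
      fun y hy => mul_le_mul_of_nonneg_left
        (parabola_le hL (Nat.lt_succ_iff.mp (Finset.mem_range.mp hy))) (hnn y)
    have hRg : g x ≤ R * g x := le_mul_of_one_le_left (by linarith [hg x hx]) hR1
    rcases Nat.eq_zero_or_pos x with rfl | hx0
    · have h1 : ∑ y ∈ Finset.range (2 * L + 1), κ 0 y * (3 / 2 - parabola L y) ≥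
          κ 0 1 * (3 / 2 - parabola L 1) :=
        Finset.single_le_sum (f := fun y => κ 0 y * (3 / 2 - parabola L y))
          (fun y hy => by linarith [hle y hy])
          (Finset.mem_range.2 (by omega))
      simp only [mul_sub, Finset.sum_sub_distrib] at h1
      rw [← Finset.sum_mul, hsum, hκ01] at h1
      have h2 : p * (1 / (2 * L)) ≤ p * (3 / 2 - parabola L 1) := by
        gcongr
        linarith [parabola_one_le hL]
      have h3 : p * (1 / (2 * L)) = 3 / 2 * a := by
        rw [ha_def]
        field_simp
      linarith
    · rcases hx.lt_or_eq with hxL | rfl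
      · obtain ⟨hl, hr⟩ := hint x hx0 hxL
        rw [sum_mul_of_two_halves hnn hsum (by omega) (by omega) (by omega) hl hr,
          parabola_average hL hx0, hgx x hx0.ne']
        have : 1 / (2 * (L : ℝ) ^ 2) * 1 ≤ 1 / (2 * (L : ℝ) ^ 2) * parabola L x := by
          gcongr
          exact one_le_parabola L x
        rw [hR_def]
        linarith
      · have h1 := Finset.sum_le_sum hle
        rw [← Finset.sum_mul, hsum] at h1
        have h2 := hgx (2 * L) hx0.ne'
        rw [parabola_two_mul hL] at h2
        linarith
  set n := ⌊s * (L : ℝ) ^ 2⌋₊ with hn_def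
  have hmain := measure_cylinder_visitsToZero_le (v := t * L) (fun x hx => (hκ x hx).1)
    (fun x hx => (hκ x hx).2.1) hP ha (by linarith) hg hstep n 0 0 (Nat.zero_le _)
  have hstart : ∀ᵐ ω ∂P, ω 0 = 0 := by
    rw [ae_iff]
    have hsub : { ω : ℕ → ℕ | ¬ ω 0 = 0 } ⊆
        ⋃ x : ℕ, { ω | ∀ i ≤ 0, ω i = (fun _ => x + 1 : ℕ → ℕ) i } := by
      intro ω hω
      obtain ⟨x, hx⟩ := Nat.exists_eq_succ_of_ne_zero hω
      refine Set.mem_iUnion.2 ⟨x, fun i hi => ?_⟩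
      rw [Nat.le_zero.mp hi, hx]
    refine measure_mono_null hsub (measure_iUnion_null fun x => ?_)
    rw [hP]
    simp
  have hRn : R ^ n ≤ 2 ^ s := by
    have hn : (n : ℝ) ≤ s * (L : ℝ) ^ 2 := Nat.floor_le (by positivity)
    calc R ^ n ≤ Real.exp (1 / (2 * (L : ℝ) ^ 2)) ^ n := by
          gcongr
          linarith [Real.add_one_le_exp (1 / (2 * (L : ℝ) ^ 2))]
      _ = Real.exp (n * (1 / (2 * (L : ℝ) ^ 2))) := (Real.exp_nat_mul _ _).symm
      _ ≤ Real.exp (Real.log 2 * s) := by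
          apply Real.exp_le_exp.2
          calc n * (1 / (2 * (L : ℝ) ^ 2)) ≤ s * (L : ℝ) ^ 2 * (1 / (2 * (L : ℝ) ^ 2)) := by
                gcongr
            _ = 1 / 2 * s := by field_simp
            _ ≤ Real.log 2 * s := by
                gcongr
                linarith [Real.log_two_gt_d9]
      _ = 2 ^ s := (Real.rpow_def_of_pos two_pos s).symm
  have hvisits : visitsToZero 0 0 = 1 := by simp [visitsToZero]
  have hval : R ^ n * g 0 * Real.exp (a * (visitsToZero 0 0 - t * L)) ≤
      2 ^ (2 + s) * Real.exp (-(1 / 3) * p * t) := by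
    have hexp : g 0 * Real.exp (a * (visitsToZero 0 0 - t * L)) =
        3 / 2 * Real.exp (-(1 / 3) * p * t) := by
      simp only [g, parabola_zero hL, hvisits]
      rw [mul_assoc, ← Real.exp_add]
      congr 2
      rw [ha_def]
      push_cast
      field_simp
      ring
    rw [mul_assoc, hexp, ← mul_assoc, Real.rpow_add two_pos]
    refine mul_le_mul_of_nonneg_right ?_ (Real.exp_pos _).le
    have h2s : (0 : ℝ) < 2 ^ s := by positivity
    norm_num
    linarith
  calc P { ω | t * L ≤ (visitsToZero ω n : ℝ) }
      ≤ P { ω | (∀ i ≤ 0, ω i = (0 : ℕ → ℕ) i) ∧ t * L ≤ (visitsToZero ω (0 + n) : ℝ) } := by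
        refine measure_mono_ae ?_
        filter_upwards [hstart] with ω h0 hω
        refine ⟨fun i hi => ?_, ?_⟩
        · rw [Nat.le_zero.mp hi, h0]
          rfl
        · rwa [zero_add]
    _ ≤ _ := hmain
    _ ≤ 1 * ENNReal.ofReal (2 ^ (2 + s) * Real.exp (-(1 / 3) * p * t)) := by
        gcongr ?_ * ENNReal.ofReal ?_
        · exact prob_le_one
        · exact hval
    _ = _ := one_mul _
end

section
/- There exists a universal finite constant c (independent of the graph G and of the vertices x, y) such that for every k ∈ {1, 2, 3, 4}, the k-th moment of η satisfies |E_x[η^k]| ≤ c · d_G(x,y)^{k−1}. -/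
open MeasureTheory Finset ENNReal

/-- The first return time to `x` of the trajectory `ω` (the least `n ≥ 1` with `ω n = x`;
by convention `sInf ∅ = 0`, which for the walks considered is an almost-surely irrelevant
convention since the walk on a finite connected graph returns almost surely). -/
noncomputable def firstReturn {V : Type*} [DecidableEq V] (x : V) (ω : ℕ → V) : ℕ :=
  sInf { n : ℕ | 1 ≤ n ∧ ω n = x }

/-- The number of visits to `y` strictly before the first return to `x`. -/
noncomputable def visitsBeforeReturn {V : Type*} [DecidableEq V] (x y : V) (ω : ℕ → V) : ℕ :=
  ((Finset.range (firstReturn x ω)).filter fun n => 1 ≤ n ∧ ω n = y).card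

/-- The one-step transition probability of the simple random walk on `G`: from `v`, jump to a
uniformly chosen neighbour of `v`. -/
noncomputable def srwStep {V : Type*} [Fintype V] (G : SimpleGraph V) [DecidableRel G.Adj]
    (v w : V) : ℝ≥0∞ :=
  if G.Adj v w then ((G.degree v : ℝ≥0∞))⁻¹ else 0

section Potential

variable {V : Type*} [Fintype V] [DecidableEq V] (G : SimpleGraph V) [DecidableRel G.Adj]

/-- Minimum principle: a function vanishing at `x` and superharmonic off `x` is nonnegative. -/
theorem nonneg_of_superharmonic_off (hG : G.Connected) (x : V) (h : V → ℝ) (hx : h x = 0)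
    (hsuper : ∀ u, u ≠ x → 0 ≤ ∑ v ∈ G.neighborFinset u, (h u - h v)) (u : V) : 0 ≤ h u := by
  obtain ⟨m, -, hm⟩ := Finset.exists_min_image Finset.univ h ⟨x, Finset.mem_univ x⟩
  have key : ∀ (a b : V), G.Walk a b → b = x → h a = h m → h m = 0 := by
    intro a b p
    induction p with
    | nil => rintro rfl ha; rw [← ha, hx]
    | @cons a c b hac p ih =>
      intro hb ha
      by_cases hax : a = x
      · rw [← ha, hax, hx]
      refine ih hb ?_
      have hle : ∀ v ∈ G.neighborFinset a, h a - h v ≤ 0 := fun v _ => by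
        have := hm v (Finset.mem_univ v)
        linarith
      have hzero := (Finset.sum_eq_zero_iff_of_nonpos hle).1
        (le_antisymm (Finset.sum_nonpos hle) (hsuper a hax)) c (by simpa using hac)
      linarith
  obtain ⟨p⟩ := hG.preconnected m x
  have := hm u (Finset.mem_univ u)
  rw [key m x p rfl rfl] at this
  exact this

/-- The Laplacian of `G` with the row at `x` replaced by evaluation at `x`. -/
def groundedLaplacian (x : V) : (V → ℝ) →ₗ[ℝ] (V → ℝ) where
  toFun h u := if u = x then h x else ∑ v ∈ G.neighborFinset u, (h u - h v)
  map_add' f g := by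
    ext u
    by_cases hu : u = x
    · simp [hu]
    · simp only [hu, if_false, Pi.add_apply, ← Finset.sum_add_distrib]
      exact Finset.sum_congr rfl fun v _ => by ring
  map_smul' a f := by
    ext u
    by_cases hu : u = x
    · simp [hu]
    · simp only [hu, if_false, Pi.smul_apply, smul_eq_mul, RingHom.id_apply, Finset.mul_sum]
      exact Finset.sum_congr rfl fun v _ => by ring

theorem groundedLaplacian_injective (hG : G.Connected) (x : V) :
    Function.Injective (groundedLaplacian G x) := by
  rw [injective_iff_map_eq_zero]
  intro f hf
  have hfx : f x = 0 := by simpa [groundedLaplacian] using congrFun hf x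
  have hfu : ∀ u, u ≠ x → ∑ v ∈ G.neighborFinset u, (f u - f v) = 0 := fun u hu => by
    simpa [groundedLaplacian, hu] using congrFun hf u
  ext u
  refine le_antisymm ?_ (nonneg_of_superharmonic_off G hG x f hfx (fun u hu => (hfu u hu).ge) u)
  have := nonneg_of_superharmonic_off G hG x (-f) (by simp [hfx]) (fun u hu => by
    have h := hfu u hu
    have h' : ∑ v ∈ G.neighborFinset u, ((-f) u - (-f) v)
        = -∑ v ∈ G.neighborFinset u, (f u - f v) := by
      rw [← Finset.sum_neg_distrib]
      exact Finset.sum_congr rfl fun v _ => by simp only [Pi.neg_apply]; ring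
    rw [h', h, neg_zero]) u
  simpa using this

/-- The net flow out of a set is carried by the edges leaving the set. -/
theorem sum_laplacian_eq_boundary (h : V → ℝ) (S : Finset V) :
    ∑ u ∈ S, ∑ v ∈ G.neighborFinset u, (h u - h v)
      = ∑ u ∈ S, ∑ v ∈ Sᶜ, if G.Adj u v then h u - h v else 0 := by
  have hin : ∑ u ∈ S, ∑ v ∈ S, (if G.Adj u v then h u - h v else 0) = 0 := by
    have hswap : ∑ u ∈ S, ∑ v ∈ S, (if G.Adj u v then h u - h v else 0)
        = -∑ u ∈ S, ∑ v ∈ S, (if G.Adj u v then h u - h v else 0) := by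
      conv_lhs => rw [Finset.sum_comm]
      simp only [← Finset.sum_neg_distrib]
      refine Finset.sum_congr rfl fun u _ => Finset.sum_congr rfl fun v _ => ?_
      by_cases huv : G.Adj u v
      · simp [huv, huv.symm]
      · simp [huv, mt SimpleGraph.Adj.symm huv]
    linarith
  have hrow : ∀ u, ∑ v ∈ G.neighborFinset u, (h u - h v)
      = ∑ v ∈ S, (if G.Adj u v then h u - h v else 0)
        + ∑ v ∈ Sᶜ, if G.Adj u v then h u - h v else 0 := fun u => by
    rw [Finset.sum_add_sum_compl, ← Finset.sum_filter]
    exact Finset.sum_congr (by ext; simp) fun _ _ => rfl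
  simp only [hrow, Finset.sum_add_distrib, hin, zero_add]

/-- The expected number of visits to `y` before hitting `x`, as a function of the starting
point, together with its value at `y` and its average over the neighbours of `x`. -/
theorem exists_green_function (hG : G.Connected) {x y : V} (hxy : x ≠ y) :
    ∃ h : V → ℝ, h x = 0 ∧ (∀ u, 0 ≤ h u) ∧
      (∀ u, u ≠ x → ∑ v ∈ G.neighborFinset u, (h u - h v) = if u = y then (G.degree y : ℝ) else 0) ∧
      ∑ v ∈ G.neighborFinset x, h v = G.degree y ∧
      h y ≤ G.degree y * G.dist x y := by
  obtain ⟨h, hh⟩ := (LinearMap.injective_iff_surjective.1 (groundedLaplacian_injective G hG x))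
    (fun u => if u = y then (G.degree y : ℝ) else 0)
  have hx : h x = 0 := by simpa [groundedLaplacian, hxy] using congrFun hh x
  have hu : ∀ u, u ≠ x →
      ∑ v ∈ G.neighborFinset u, (h u - h v) = if u = y then (G.degree y : ℝ) else 0 :=
    fun u hu => by simpa [groundedLaplacian, hu] using congrFun hh u
  have h0 : ∀ u, 0 ≤ h u := nonneg_of_superharmonic_off G hG x h hx fun u hux => by
    rw [hu u hux]; positivity
  refine ⟨h, hx, h0, hu, ?_, ?_⟩
  · have htot := sum_laplacian_eq_boundary G h Finset.univ
    rw [Finset.compl_univ] at htot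
    simp only [Finset.sum_empty, Finset.sum_const_zero] at htot
    rw [← Finset.add_sum_erase _ _ (Finset.mem_univ x), Finset.sum_congr rfl
      (fun u hmem => hu u (Finset.ne_of_mem_erase hmem))] at htot
    simp only [Finset.sum_ite_eq', Finset.mem_erase, Finset.mem_univ, and_true, hxy.symm, ne_eq,
      not_false_eq_true, if_true, hx, zero_sub, Finset.sum_neg_distrib] at htot
    linarith
  · have hedge : ∀ u v, G.Adj u v → h v ≤ h u + G.degree y := by
      intro v u huv
      by_contra! hlt
      have hdeg : (0 : ℝ) ≤ G.degree y := by positivity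
      set S : Finset V := Finset.univ.filter fun w => h u ≤ h w with hS
      have hxS : ∀ w ∈ S, w ≠ x := by
        rintro w hw rfl
        have h1 : h u ≤ h w := (Finset.mem_filter.1 hw).2
        have := h0 v
        linarith
      have hflow := sum_laplacian_eq_boundary G h S
      rw [Finset.sum_congr rfl fun w hw => hu w (hxS w hw), Finset.sum_ite_eq'] at hflow
      have hnn : ∀ a ∈ S, ∀ b ∈ Sᶜ, 0 ≤ if G.Adj a b then h a - h b else 0 := by
        intro a ha b hb
        simp only [hS, Finset.mem_compl, Finset.mem_filter, Finset.mem_univ, true_and,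
          not_le] at ha hb
        split_ifs <;> linarith
      have huS : u ∈ S := by simp [hS]
      have hvS : v ∈ Sᶜ := by
        simp only [hS, Finset.mem_compl, Finset.mem_filter, Finset.mem_univ, true_and, not_le]
        linarith
      have h1 := Finset.single_le_sum (fun b hb => hnn u huS b hb) hvS
      have h2 := Finset.single_le_sum (fun a ha => Finset.sum_nonneg (hnn a ha)) huS
      simp only [huv.symm, if_true] at h1
      have h3 : (if y ∈ S then (G.degree y : ℝ) else 0) ≤ G.degree y := by
        split_ifs <;> simp
      linarith
    have hwalk : ∀ a b (p : G.Walk a b), h b ≤ h a + G.degree y * p.length := by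
      intro a b p
      induction p with
      | nil => simp
      | cons hab p ih =>
        have := hedge _ _ hab
        rw [SimpleGraph.Walk.length_cons]
        push_cast
        linarith
    obtain ⟨p, hp⟩ := hG.exists_walk_length_eq_dist x y
    have := hwalk x y p
    rwa [hx, zero_add, hp] at this

end Potential

section Walk

variable {V : Type}

/-- A trajectory agreeing with the given tuple on its first coordinates. -/
def extendTuple {n : ℕ} (t : Fin (n + 1) → V) (i : ℕ) : V :=
  if hi : i < n + 1 then t ⟨i, hi⟩ else t 0

theorem extendTuple_of_le {n i : ℕ} (t : Fin (n + 1) → V) (hi : i ≤ n) :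
    extendTuple t i = t ⟨i, Nat.lt_succ_of_le hi⟩ :=
  dif_pos (Nat.lt_succ_of_le hi)

variable [Fintype V]

theorem sum_srwStep_mul_ofReal (G : SimpleGraph V) [DecidableRel G.Adj] (u : V)
    (hu : 0 < G.degree u) (f : V → ℝ) (hf : ∀ v, 0 ≤ f v) :
    ∑ v, srwStep G u v * ENNReal.ofReal (f v)
      = ENNReal.ofReal ((∑ v ∈ G.neighborFinset u, f v) / G.degree u) := by
  have hu' : (0 : ℝ) < G.degree u := by exact_mod_cast hu
  rw [ENNReal.ofReal_div_of_pos hu', ENNReal.ofReal_natCast,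
    ENNReal.ofReal_sum_of_nonneg fun v _ => hf v, ENNReal.div_eq_inv_mul, Finset.mul_sum]
  simp only [srwStep, ite_mul, zero_mul]
  rw [← Finset.sum_filter]
  exact Finset.sum_congr (by ext; simp) fun _ _ => rfl

variable [MeasurableSpace V] [DiscreteMeasurableSpace V]

theorem measurable_of_depends_finite {n : ℕ} {g : (ℕ → V) → ℝ≥0∞}
    (hg : ∀ ω ω' : ℕ → V, (∀ i ≤ n, ω i = ω' i) → g ω = g ω') : Measurable g := by
  have heq : g = (fun t : Fin (n + 1) → V => g (extendTuple t)) ∘ fun ω i => ω i := by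
    ext ω
    exact hg _ _ fun i hi => by rw [extendTuple_of_le _ hi]
  rw [heq]
  exact (measurable_of_countable _).comp (measurable_pi_lambda _ fun i => measurable_pi_apply _)

variable (G : SimpleGraph V) [DecidableRel G.Adj]

/-- The Markov property: the last step may be averaged out. -/
theorem lintegral_srw_step [DecidableEq V] {x : V} {P : Measure (ℕ → V)}
    (hP : ∀ (n : ℕ) (tr : ℕ → V), P { ω | ∀ i ≤ n, ω i = tr i } =
      if tr 0 = x then ∏ i ∈ Finset.range n, srwStep G (tr i) (tr (i + 1)) else 0)
    (n : ℕ) (g : (ℕ → V) → V → ℝ≥0∞)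
    (hg : ∀ ω ω' : ℕ → V, (∀ i ≤ n, ω i = ω' i) → g ω = g ω') :
    ∫⁻ ω, g ω (ω (n + 1)) ∂P = ∫⁻ ω, ∑ v, srwStep G (ω n) v * g ω v ∂P := by
  have hr : Measurable fun (ω : ℕ → V) (i : Fin (n + 1)) => ω i :=
    measurable_pi_lambda _ fun i => measurable_pi_apply _
  have hcyl : ∀ t : Fin (n + 1) → V, (fun (ω : ℕ → V) (i : Fin (n + 1)) => ω i) ⁻¹' {t}
      = {ω | ∀ i ≤ n, ω i = extendTuple t i} := by
    intro t
    ext ω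
    simp only [Set.mem_preimage, Set.mem_singleton_iff, Set.mem_ofPred_eq, funext_iff]
    refine ⟨fun h i hi => by rw [extendTuple_of_le _ hi, ← h], fun h i => ?_⟩
    rw [h i (Nat.le_of_lt_succ i.2), extendTuple_of_le _ (Nat.le_of_lt_succ i.2)]
  have hext : ∀ ω : ℕ → V, g ω = g (extendTuple fun i : Fin (n + 1) => ω i) := fun ω =>
    hg _ _ fun i hi => by rw [extendTuple_of_le _ hi]
  have hL : ∫⁻ ω, g ω (ω (n + 1)) ∂P
      = ∑ t : Fin (n + 1) → V, ∑ v, g (extendTuple t) v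
        * (P {ω | ∀ i ≤ n, ω i = extendTuple t i} * srwStep G (extendTuple t n) v) := by
    have hm : Measurable fun ω : ℕ → V => ((fun i : Fin (n + 1) => ω i), ω (n + 1)) :=
      hr.prodMk (measurable_pi_apply _)
    have h1 : ∫⁻ ω, g ω (ω (n + 1)) ∂P
        = ∫⁻ q : (Fin (n + 1) → V) × V, g (extendTuple q.1) q.2 ∂(P.map fun ω : ℕ → V =>
            ((fun i : Fin (n + 1) => ω i), ω (n + 1))) := by
      rw [lintegral_map (measurable_of_countable _) hm]
      exact lintegral_congr fun ω => by rw [hext ω]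
    rw [h1, lintegral_fintype, Fintype.sum_prod_type]
    refine Finset.sum_congr rfl fun t _ => Finset.sum_congr rfl fun v _ => ?_
    rw [Measure.map_apply hm (measurableSet_singleton _)]
    congr 1
    set tr : ℕ → V := fun i => if i ≤ n then extendTuple t i else v with htr
    have hset : (fun ω : ℕ → V => ((fun i : Fin (n + 1) => ω i), ω (n + 1))) ⁻¹' {(t, v)}
        = {ω | ∀ i ≤ n + 1, ω i = tr i} := by
      ext ω
      have h2 := Set.ext_iff.1 (hcyl t) ω
      simp only [Set.mem_preimage, Set.mem_singleton_iff, Set.mem_ofPred_eq] at h2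
      simp only [Set.mem_preimage, Set.mem_singleton_iff, Set.mem_ofPred_eq, Prod.mk.injEq, h2]
      constructor
      · rintro ⟨ha, hb⟩ i hi
        rcases Nat.lt_or_ge n i with h | h
        · obtain rfl : i = n + 1 := by omega
          simp [htr, hb]
        · simp [htr, h, ha i h]
      · intro ha
        refine ⟨fun i hi => ?_, ?_⟩
        · rw [ha i (by omega)]; simp [htr, hi]
        · rw [ha (n + 1) le_rfl]; simp [htr]
    rw [hset, hP, hP, Finset.prod_range_succ, ite_mul, zero_mul]
    have hprod : ∏ i ∈ Finset.range n, srwStep G (tr i) (tr (i + 1))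
        = ∏ i ∈ Finset.range n, srwStep G (extendTuple t i) (extendTuple t (i + 1)) := by
      refine Finset.prod_congr rfl fun i hi => ?_
      have := Finset.mem_range.1 hi
      simp [htr, show i ≤ n by omega, show i + 1 ≤ n by omega]
    rw [hprod]
    simp [htr]
  have hR : ∫⁻ ω, ∑ v, srwStep G (ω n) v * g ω v ∂P
      = ∑ t : Fin (n + 1) → V, (∑ v, srwStep G (extendTuple t n) v * g (extendTuple t) v)
        * P {ω | ∀ i ≤ n, ω i = extendTuple t i} := by
    have h1 : ∫⁻ ω, ∑ v, srwStep G (ω n) v * g ω v ∂P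
        = ∫⁻ t : Fin (n + 1) → V, ∑ v, srwStep G (extendTuple t n) v * g (extendTuple t) v
          ∂(P.map fun (ω : ℕ → V) (i : Fin (n + 1)) => ω i) := by
      rw [lintegral_map (measurable_of_countable _) hr]
      refine lintegral_congr fun ω => ?_
      rw [hext ω, extendTuple_of_le _ le_rfl]
    rw [h1, lintegral_fintype]
    refine Finset.sum_congr rfl fun t _ => ?_
    rw [Measure.map_apply hr (measurableSet_singleton _), hcyl]
  rw [hL, hR]
  refine Finset.sum_congr rfl fun t _ => ?_
  rw [Finset.sum_mul]
  exact Finset.sum_congr rfl fun v _ => by ring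

end Walk

section Excursion

variable {V : Type}

/-- The trajectory does not visit `x` at times `1, …, n`. -/
def AvoidsUpTo (x : V) (n : ℕ) (ω : ℕ → V) : Prop := ∀ j, 1 ≤ j → j ≤ n → ω j ≠ x

theorem avoidsUpTo_succ (x : V) (n : ℕ) (ω : ℕ → V) :
    AvoidsUpTo x (n + 1) ω ↔ AvoidsUpTo x n ω ∧ ω (n + 1) ≠ x := by
  refine ⟨fun h => ⟨fun j h1 h2 => h j h1 (by omega), h _ (by omega) le_rfl⟩, ?_⟩
  rintro ⟨h1, h2⟩ j hj hjn
  rcases Nat.lt_or_ge n j with h | h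
  · obtain rfl : j = n + 1 := by omega
    exact h2
  · exact h1 j hj h

theorem avoidsUpTo_congr (x : V) {n : ℕ} {ω ω' : ℕ → V} (h : ∀ i ≤ n, ω i = ω' i) :
    AvoidsUpTo x n ω ↔ AvoidsUpTo x n ω' := by
  refine forall_congr' fun j => forall_congr' fun _ => forall_congr' fun hj => ?_
  rw [h j hj]

variable [DecidableEq V]

instance (x : V) (n : ℕ) (ω : ℕ → V) : Decidable (AvoidsUpTo x n ω) :=
  have : Decidable (∀ j ∈ Finset.Icc 1 n, ω j ≠ x) := Finset.decidableDforallFinset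
  decidable_of_iff (∀ j ∈ Finset.Icc 1 n, ω j ≠ x) (by simp [AvoidsUpTo])

/-- The number of visits to `y` at times `1, …, n` before the first return to `x`. -/
def visitsUpTo (x y : V) (n : ℕ) (ω : ℕ → V) : ℕ :=
  ∑ i ∈ Finset.range n, if ω (i + 1) = y ∧ AvoidsUpTo x (i + 1) ω then 1 else 0

theorem visitsUpTo_congr (x y : V) {n : ℕ} {ω ω' : ℕ → V} (h : ∀ i ≤ n, ω i = ω' i) :
    visitsUpTo x y n ω = visitsUpTo x y n ω' := by
  refine Finset.sum_congr rfl fun i hi => ?_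
  have hi := Finset.mem_range.1 hi
  simp only [h (i + 1) hi, avoidsUpTo_congr x fun j (hj : j ≤ i + 1) => h j (by omega)]

theorem visitsBeforeReturn_le_visitsUpTo (x y : V) {n : ℕ} {ω : ℕ → V}
    (hn : firstReturn x ω ≤ n) : visitsBeforeReturn x y ω ≤ visitsUpTo x y n ω := by
  rw [visitsUpTo, ← Finset.sum_filter, ← Finset.card_eq_sum_ones, visitsBeforeReturn]
  refine Finset.card_le_card_of_injOn (fun i => i - 1) ?_ ?_
  · intro i hi
    simp only [Finset.coe_filter, Finset.mem_range, Set.mem_ofPred_eq] at hi ⊢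
    obtain ⟨h1, h2, h3⟩ := hi
    rw [Nat.sub_add_cancel h2]
    refine ⟨by omega, h3, fun j hj hji hx => ?_⟩
    exact Nat.notMem_of_lt_sInf (s := {n : ℕ | 1 ≤ n ∧ ω n = x}) (lt_of_le_of_lt hji h1) ⟨hj, hx⟩
  · intro i hi j hj hij
    simp only [Finset.coe_filter, Finset.mem_range, Set.mem_ofPred_eq] at hi hj hij
    omega

end Excursion

/-- If `w ≥ 1` equals `1` at `x` and, off `x`, is preserved by one step of the walk weighted by
`θ` per visit to `y`, then `E_x[θ ^ N]` is at most the average of `w` over the neighbours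
of `x`. -/
theorem lintegral_pow_visits_le {V : Type} [Fintype V] [DecidableEq V] [MeasurableSpace V]
    [DiscreteMeasurableSpace V] (G : SimpleGraph V) [DecidableRel G.Adj]
    (hdeg : ∀ u, 0 < G.degree u) {x y : V}
    {P : Measure (ℕ → V)} [IsProbabilityMeasure P]
    (hP : ∀ (n : ℕ) (tr : ℕ → V), P { ω | ∀ i ≤ n, ω i = tr i } =
      if tr 0 = x then ∏ i ∈ Finset.range n, srwStep G (tr i) (tr (i + 1)) else 0)
    {θ : ℝ} (hθ : 1 ≤ θ) {w : V → ℝ} (hw1 : ∀ u, 1 ≤ w u) (hwx : w x = 1)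
    (hw : ∀ u, u ≠ x →
      (if u = y then θ else 1) * ((∑ v ∈ G.neighborFinset u, w v) / G.degree u) = w u) :
    ∫⁻ ω, ENNReal.ofReal (θ ^ visitsBeforeReturn x y ω) ∂P
      ≤ ENNReal.ofReal ((∑ v ∈ G.neighborFinset x, w v) / G.degree x) := by
  have hw0 : ∀ u, 0 ≤ w u := fun u => zero_le_one.trans (hw1 u)
  have hθ0 : 0 ≤ θ := zero_le_one.trans hθ
  set F : ℕ → (ℕ → V) → V → ℝ := fun n ω v =>
    θ ^ visitsUpTo x y n ω * if AvoidsUpTo x n ω then w v else 1 with hF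
  have hF0 : ∀ n ω v, 0 ≤ F n ω v := fun n ω v => by
    simp only [hF]
    split_ifs
    · exact mul_nonneg (pow_nonneg hθ0 _) (hw0 v)
    · exact mul_nonneg (pow_nonneg hθ0 _) zero_le_one
  have hFcongr : ∀ n, ∀ ω ω' : ℕ → V, (∀ i ≤ n, ω i = ω' i) →
      (fun v => ENNReal.ofReal (F n ω v)) = fun v => ENNReal.ofReal (F n ω' v) := by
    intro n ω ω' h
    ext v
    simp only [hF, visitsUpTo_congr x y h, avoidsUpTo_congr x h]
  have hstep : ∀ n, ∫⁻ ω, ENNReal.ofReal (F n ω (ω (n + 1))) ∂P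
      = ∫⁻ ω, ENNReal.ofReal ((∑ v ∈ G.neighborFinset (ω n), F n ω v) / G.degree (ω n)) ∂P := by
    intro n
    rw [lintegral_srw_step G hP n (fun ω v => ENNReal.ofReal (F n ω v)) (hFcongr n)]
    exact lintegral_congr fun ω => sum_srwStep_mul_ofReal G _ (hdeg _) _ (hF0 n ω)
  have hstart : ∫⁻ ω, ENNReal.ofReal (F 0 ω (ω (0 + 1))) ∂P
      = ENNReal.ofReal ((∑ v ∈ G.neighborFinset x, w v) / G.degree x) := by
    rw [hstep 0]
    have hx0 : ∀ᵐ ω ∂P, ω 0 = x := by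
      have h := hP 0 fun _ => x
      simp only [Nat.le_zero, forall_eq, Finset.range_zero, Finset.prod_empty, if_true] at h
      have hmeas : MeasurableSet {ω : ℕ → V | ω 0 = x} :=
        measurableSet_eq_fun (measurable_pi_apply 0) measurable_const
      exact (mem_ae_iff_prob_eq_one hmeas).2 h
    rw [lintegral_congr_ae (g := fun _ =>
      ENNReal.ofReal ((∑ v ∈ G.neighborFinset x, w v) / G.degree x)) ?_]
    · simp
    · filter_upwards [hx0] with ω hω
      have havoid : AvoidsUpTo x 0 ω := fun j h1 h2 => absurd (h1.trans h2) (by norm_num)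
      simp only [hF, havoid, visitsUpTo, Finset.range_zero, Finset.sum_empty, pow_zero, one_mul,
        if_true]
      rw [hω]
  have hinv : ∀ n, ∫⁻ ω, ENNReal.ofReal (F n ω (ω (n + 1))) ∂P
      = ENNReal.ofReal ((∑ v ∈ G.neighborFinset x, w v) / G.degree x) := by
    intro n
    induction n with
    | zero => exact hstart
    | succ n ih =>
      rw [← ih, hstep (n + 1)]
      refine lintegral_congr fun ω => ?_
      congr 1
      have hdu : (G.degree (ω (n + 1)) : ℝ) ≠ 0 := by exact_mod_cast (hdeg _).ne'
      have hvis : visitsUpTo x y (n + 1) ω = visitsUpTo x y n ω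
          + if ω (n + 1) = y ∧ AvoidsUpTo x (n + 1) ω then 1 else 0 :=
        Finset.sum_range_succ _ _
      simp only [hF]
      rw [← Finset.mul_sum, hvis]
      by_cases ha : AvoidsUpTo x n ω
      · by_cases hx : ω (n + 1) = x
        · have hna : ¬ AvoidsUpTo x (n + 1) ω := fun h => ((avoidsUpTo_succ x n ω).1 h).2 hx
          simp only [hna, ha, if_true, if_false, and_false, add_zero, Finset.sum_const,
            SimpleGraph.card_neighborFinset_eq_degree, nsmul_eq_mul, mul_one]
          rw [mul_div_assoc, div_self hdu, hx, hwx]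
        · have ha' : AvoidsUpTo x (n + 1) ω := (avoidsUpTo_succ x n ω).2 ⟨ha, hx⟩
          have hwu := hw _ hx
          simp only [ha, ha', if_true, and_true]
          rw [← hwu]
          split_ifs <;> ring
      · have hna : ¬ AvoidsUpTo x (n + 1) ω := fun h => ha ((avoidsUpTo_succ x n ω).1 h).1
        simp only [hna, ha, if_false, and_false, add_zero, Finset.sum_const,
          SimpleGraph.card_neighborFinset_eq_degree, nsmul_eq_mul, mul_one]
        rw [mul_div_assoc, div_self hdu, mul_one]
  have hbound : ∀ n, ∫⁻ ω, ENNReal.ofReal (θ ^ visitsUpTo x y n ω) ∂P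
      ≤ ENNReal.ofReal ((∑ v ∈ G.neighborFinset x, w v) / G.degree x) := by
    intro n
    rw [← hinv n]
    refine lintegral_mono fun ω => ENNReal.ofReal_le_ofReal ?_
    refine le_mul_of_one_le_right (pow_nonneg hθ0 _) ?_
    split_ifs
    exacts [hw1 _, le_rfl]
  calc ∫⁻ ω, ENNReal.ofReal (θ ^ visitsBeforeReturn x y ω) ∂P
      ≤ ∫⁻ ω, Filter.liminf (fun n => ENNReal.ofReal (θ ^ visitsUpTo x y n ω)) Filter.atTop ∂P := by
        refine lintegral_mono fun ω => Filter.le_liminf_of_le (by isBoundedDefault) ?_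
        filter_upwards [Filter.eventually_ge_atTop (firstReturn x ω)] with n hn
        exact ENNReal.ofReal_le_ofReal
          (pow_le_pow_right₀ hθ (visitsBeforeReturn_le_visitsUpTo x y hn))
    _ ≤ Filter.liminf (fun n => ∫⁻ ω, ENNReal.ofReal (θ ^ visitsUpTo x y n ω) ∂P) Filter.atTop :=
        lintegral_liminf_le fun n => measurable_of_depends_finite (n := n) fun ω ω' h => by
          rw [visitsUpTo_congr x y h]
    _ ≤ _ := Filter.liminf_le_of_frequently_le' (Filter.Frequently.of_forall hbound)

theorem pow_le_factorial_mul_inv_one_sub_pow {s : ℝ} (hs0 : 0 < s) (hs1 : s < 1) {k : ℕ}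
    (hk : 1 ≤ k) (m : ℕ) : (s * m) ^ k / k.factorial ≤ ((1 - s)⁻¹) ^ m - 1 := by
  have hexp : Real.exp s ≤ (1 - s)⁻¹ := by
    rw [← neg_neg s, Real.exp_neg, neg_neg]
    refine inv_anti₀ (by linarith) ?_
    have := Real.add_one_le_exp (-s)
    linarith
  have hpow : Real.exp (s * m) ≤ ((1 - s)⁻¹) ^ m := by
    rw [mul_comm, Real.exp_nat_mul]
    exact pow_le_pow_left₀ (Real.exp_pos s).le hexp m
  have hnn : 0 ≤ s * m := by positivity
  have hsum := Real.sum_le_exp_of_nonneg hnn (k + 1)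
  have htwo : (1 : ℝ) + (s * m) ^ k / k.factorial
      ≤ ∑ i ∈ Finset.range (k + 1), (s * m) ^ i / i.factorial := by
    rw [Finset.sum_range_succ]
    have := Finset.single_le_sum (f := fun i : ℕ => (s * m) ^ i / (i.factorial : ℝ))
      (s := Finset.range k) (fun i _ => by positivity) (Finset.mem_range.2 hk)
    simp only [pow_zero, Nat.factorial_zero, Nat.cast_one, div_one] at this
    linarith
  linarith

theorem abs_sub_pow_le {a b : ℝ} (ha : 0 ≤ a) (hb : 0 ≤ b) (k : ℕ) :
    |(a - b) ^ k| ≤ a ^ k + b ^ k := by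
  rw [abs_pow]
  rcases le_total a b with h | h
  · have := pow_le_pow_left₀ (abs_nonneg (a - b)) (show |a - b| ≤ b by
      rw [abs_sub_le_iff]; constructor <;> linarith) k
    linarith [pow_nonneg ha k]
  · have := pow_le_pow_left₀ (abs_nonneg (a - b)) (show |a - b| ≤ a by
      rw [abs_sub_le_iff]; constructor <;> linarith) k
    linarith [pow_nonneg hb k]

/-- The exponential moment of the number of visits, at the scale given by the resistance bound. -/
theorem lintegral_exp_visits_sub_one_le {V : Type} [Fintype V] [DecidableEq V] [MeasurableSpace V]
    [DiscreteMeasurableSpace V] (G : SimpleGraph V) [DecidableRel G.Adj] (hG : G.Connected)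
    {x y : V} (hxy : x ≠ y) {P : Measure (ℕ → V)} [IsProbabilityMeasure P]
    (hP : ∀ (n : ℕ) (tr : ℕ → V), P { ω | ∀ i ≤ n, ω i = tr i } =
      if tr 0 = x then ∏ i ∈ Finset.range n, srwStep G (tr i) (tr (i + 1)) else 0)
    (hdeg : ∀ u, 0 < G.degree u) {s : ℝ} (hs : s = 1 / (2 * (G.degree y * G.dist x y))) :
    ∫⁻ ω, ENNReal.ofReal (((1 - s)⁻¹) ^ visitsBeforeReturn x y ω - 1) ∂P
      ≤ ENNReal.ofReal (1 / G.dist x y) := by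
  obtain ⟨h, hx, h0, hharm, hxsum, hy⟩ := exists_green_function G hG hxy
  have hd : (1 : ℝ) ≤ G.dist x y := by exact_mod_cast hG.pos_dist_of_ne hxy
  have hdy : (1 : ℝ) ≤ G.degree y := by exact_mod_cast hdeg y
  have hdx : (1 : ℝ) ≤ G.degree x := by exact_mod_cast hdeg x
  have hD : (1 : ℝ) ≤ G.degree y * G.dist x y := one_le_mul_of_one_le_of_one_le hdy hd
  have hs0 : 0 < s := by rw [hs]; positivity
  have hsD : s * (G.degree y * G.dist x y) = 1 / 2 := by rw [hs]; field_simp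
  have hs2 : s ≤ 1 / 2 := by nlinarith
  have hsh : s * h y ≤ 1 / 2 := by rw [← hsD]; gcongr
  have hpos : 0 < 1 - s * h y := by linarith
  have hs1 : 0 < 1 - s := by linarith
  set c : ℝ := s / (1 - s * h y) with hc
  have hc0 : 0 ≤ c := by positivity
  have hc2 : c ≤ 2 * s := by
    rw [hc, div_le_iff₀ hpos]
    nlinarith
  have hθ : 1 ≤ (1 - s)⁻¹ := (one_le_inv₀ hs1).2 (by linarith)
  have havg : ∀ u, (∑ v ∈ G.neighborFinset u, (1 + c * h v)) / G.degree u
      = 1 + c * ((∑ v ∈ G.neighborFinset u, h v) / G.degree u) := by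
    intro u
    have hdu : (G.degree u : ℝ) ≠ 0 := by exact_mod_cast (hdeg u).ne'
    rw [Finset.sum_add_distrib, ← Finset.mul_sum, Finset.sum_const,
      SimpleGraph.card_neighborFinset_eq_degree, nsmul_eq_mul]
    field_simp
  have hmain := lintegral_pow_visits_le (x := x) (y := y) G hdeg hP hθ (w := fun u => 1 + c * h u)
    (fun u => by have := mul_nonneg hc0 (h0 u); linarith) (by simp [hx]) (by
      intro u hu
      have hdu : (G.degree u : ℝ) ≠ 0 := by exact_mod_cast (hdeg u).ne'
      have hl := hharm u hu
      rw [Finset.sum_sub_distrib, Finset.sum_const,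
        SimpleGraph.card_neighborFinset_eq_degree, nsmul_eq_mul] at hl
      rw [havg]
      by_cases huy : u = y
      · subst huy
        simp only [if_true] at hl ⊢
        have h1 : (∑ v ∈ G.neighborFinset u, h v) / (G.degree u : ℝ) = h u - 1 := by
          field_simp
          linarith
        rw [h1, hc]
        field_simp
        ring
      · simp only [huy, if_false] at hl ⊢
        have h1 : (∑ v ∈ G.neighborFinset u, h v) / (G.degree u : ℝ) = h u := by
          field_simp
          linarith
        rw [h1, one_mul])
  rw [havg, hxsum] at hmain
  have hε : c * ((G.degree y : ℝ) / G.degree x) ≤ 1 / G.dist x y := by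
    calc c * ((G.degree y : ℝ) / G.degree x) ≤ 2 * s * (G.degree y : ℝ) := by
          gcongr
          exact div_le_self (by positivity) hdx
      _ = 1 / G.dist x y := by rw [hs]; field_simp
  have hadd : ∀ ω : ℕ → V, ENNReal.ofReal (((1 - s)⁻¹) ^ visitsBeforeReturn x y ω)
      = ENNReal.ofReal (((1 - s)⁻¹) ^ visitsBeforeReturn x y ω - 1) + 1 := by
    intro ω
    rw [← ENNReal.ofReal_one, ← ENNReal.ofReal_add (sub_nonneg.2 (one_le_pow₀ hθ)) zero_le_one,
      sub_add_cancel]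
  simp only [hadd] at hmain
  rw [lintegral_add_right _ measurable_const, lintegral_one, measure_univ, add_comm (1 : ℝ),
    ENNReal.ofReal_add (by positivity) zero_le_one, ENNReal.ofReal_one] at hmain
  exact ((ENNReal.add_le_add_iff_right ENNReal.one_ne_top).1 hmain).trans
    (ENNReal.ofReal_le_ofReal hε)

/-- There is a universal finite constant `c` (independent of the graph and of the vertices)
such that for the simple random walk on any finite connected graph `G` started at `x`, with
`N` the number of visits to `y ≠ x` before the first return to `x` and
`η := N / deg(y) − 1 / deg(x)`, one has `|E_x[η^k]| ≤ c ⋅ d_G(x,y)^{k−1}` for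
`k ∈ {1, 2, 3, 4}`. The law `P` of the walk is characterized by its cylinder probabilities. -/
theorem eta_moment_bound :
    ∃ c : ℝ, 0 < c ∧
      ∀ (V : Type) [Fintype V] [DecidableEq V] [MeasurableSpace V] [DiscreteMeasurableSpace V]
        (G : SimpleGraph V) [DecidableRel G.Adj], G.Connected →
      ∀ x y : V, x ≠ y →
      ∀ P : Measure (ℕ → V), IsProbabilityMeasure P →
        (∀ (n : ℕ) (tr : ℕ → V),
          P { ω | ∀ i ≤ n, ω i = tr i } =
            if tr 0 = x then ∏ i ∈ Finset.range n, srwStep G (tr i) (tr (i + 1)) else 0) →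
      ∀ k : ℕ, 1 ≤ k → k ≤ 4 →
        |∫ ω, ((visitsBeforeReturn x y ω : ℝ) / (G.degree y : ℝ) -
            1 / (G.degree x : ℝ)) ^ k ∂P| ≤
          c * (G.dist x y : ℝ) ^ (k - 1) := by
  refine ⟨385, by norm_num, ?_⟩
  intro V _ _ _ _ G _ hG x y hxy P _ hP k hk1 hk4
  have : Nontrivial V := ⟨x, y, hxy⟩
  have hdeg : ∀ u, 0 < G.degree u := fun u => hG.preconnected.degree_pos_of_nontrivial u
  have hd : (1 : ℝ) ≤ G.dist x y := by exact_mod_cast hG.pos_dist_of_ne hxy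
  have hdy : (1 : ℝ) ≤ G.degree y := by exact_mod_cast hdeg y
  have hdx : (1 : ℝ) ≤ G.degree x := by exact_mod_cast hdeg x
  have hD : (1 : ℝ) ≤ G.degree y * G.dist x y := one_le_mul_of_one_le_of_one_le hdy hd
  obtain ⟨s, hs⟩ : ∃ s : ℝ, s = 1 / (2 * (G.degree y * G.dist x y)) := ⟨_, rfl⟩
  have hs0 : 0 < s := by rw [hs]; positivity
  have hs1 : s < 1 := by
    rw [hs, div_lt_one (by positivity)]
    linarith
  have hexp := lintegral_exp_visits_sub_one_le G hG hxy hP hdeg hs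
  set K : ℝ := k.factorial * (2 * G.dist x y) ^ k with hK
  have hK0 : 0 ≤ K := by positivity
  have hpoint : ∀ ω : ℕ → V, |((visitsBeforeReturn x y ω : ℝ) / (G.degree y : ℝ) -
      1 / (G.degree x : ℝ)) ^ k|
      ≤ K * (((1 - s)⁻¹) ^ visitsBeforeReturn x y ω - 1) + 1 := by
    intro ω
    refine (abs_sub_pow_le (by positivity) (by positivity) k).trans (add_le_add ?_ ?_)
    · have h := pow_le_factorial_mul_inv_one_sub_pow hs0 hs1 hk1 (visitsBeforeReturn x y ω)
      refine le_trans (le_of_eq ?_) (mul_le_mul_of_nonneg_left h hK0)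
      have hfac : (k.factorial : ℝ) ≠ 0 := by positivity
      rw [hK, mul_assoc, ← mul_div_assoc, ← mul_pow, mul_div_cancel₀ _ hfac]
      congr 1
      rw [hs]
      field_simp
    · exact pow_le_one₀ (by positivity) (div_le_one_of_le₀ hdx (by positivity))
  have hθ : 1 ≤ (1 - s)⁻¹ := (one_le_inv₀ (by linarith)).2 (by linarith)
  have hlint : ∫⁻ ω, ENNReal.ofReal ‖((visitsBeforeReturn x y ω : ℝ) / (G.degree y : ℝ) -
      1 / (G.degree x : ℝ)) ^ k‖ ∂P ≤ ENNReal.ofReal (K * (1 / G.dist x y) + 1) := by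
    calc _ ≤ ∫⁻ ω, (ENNReal.ofReal K *
          ENNReal.ofReal (((1 - s)⁻¹) ^ visitsBeforeReturn x y ω - 1) + 1) ∂P := by
          refine lintegral_mono fun ω => ?_
          rw [← ENNReal.ofReal_mul hK0, ← ENNReal.ofReal_one, ← ENNReal.ofReal_add
            (mul_nonneg hK0 (sub_nonneg.2 (one_le_pow₀ hθ))) zero_le_one]
          exact ENNReal.ofReal_le_ofReal (hpoint ω)
      _ = ENNReal.ofReal K *
          ∫⁻ ω, ENNReal.ofReal (((1 - s)⁻¹) ^ visitsBeforeReturn x y ω - 1) ∂P + 1 := by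
          rw [lintegral_add_right _ measurable_const, lintegral_one, measure_univ,
            lintegral_const_mul' _ _ ENNReal.ofReal_ne_top]
      _ ≤ ENNReal.ofReal K * ENNReal.ofReal (1 / G.dist x y) + 1 := by gcongr
      _ = _ := by
          rw [← ENNReal.ofReal_mul hK0, ← ENNReal.ofReal_one,
            ← ENNReal.ofReal_add (by positivity) zero_le_one]
  rw [← Real.norm_eq_abs]
  refine (norm_integral_le_lintegral_norm _).trans ?_
  refine (ENNReal.toReal_le_of_le_ofReal (by positivity) hlint).trans ?_
  have hKd : K * (1 / G.dist x y) = k.factorial * 2 ^ k * (G.dist x y : ℝ) ^ (k - 1) := by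
    obtain ⟨j, rfl⟩ : ∃ j, k = j + 1 := ⟨k - 1, by omega⟩
    rw [hK, Nat.add_sub_cancel, mul_pow, pow_succ (G.dist x y : ℝ) j]
    field_simp
  have hnum : (k.factorial : ℝ) * 2 ^ k ≤ 384 := by
    interval_cases k <;> norm_num [Nat.factorial]
  have hone : (1 : ℝ) ≤ (G.dist x y : ℝ) ^ (k - 1) := one_le_pow₀ hd
  rw [hKd]
  nlinarith
end

section
/- Suppose that for every ε > 0 there exists a correspondence ℭ between K and K' such that (X_t, X'_t) ∈ ℭ for all t ∈ [0,1] and dis ℭ ≤ ε. Then there exists a surjective isometry ψ : K → K' such that X'_t = ψ(X_t) for all t ∈ [0,1]; that is, the two path-decorated compact metric spaces are path-preserving isometric. -/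
open Filter Topology in
/-- In a compact space every sequence converges along every ultrafilter. -/
theorem exists_tendsto_ultrafilter_of_compactSpace {ι Y : Type*} [TopologicalSpace Y]
    [CompactSpace Y] (U : Ultrafilter ι) (u : ι → Y) : ∃ y, Tendsto u U (𝓝 y) := by
  obtain ⟨y, -, hy⟩ := isCompact_univ.ultrafilter_le_nhds (U.map u) (by simp)
  exact ⟨y, hy⟩

open Filter Topology in
/-- Along relations whose distortion tends to zero, limits of related pairs are at equal
distances. -/
theorem dist_eq_dist_of_tendsto_of_distortion {ι K K' : Type*} [PseudoMetricSpace K]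
    [PseudoMetricSpace K'] {l : Filter ι} [l.NeBot] {ε : ι → ℝ} (hε : Tendsto ε l (𝓝 0))
    {C : ι → Set (K × K')}
    (hC : ∀ i, ∀ p ∈ C i, ∀ q ∈ C i, |dist p.1 q.1 - dist p.2 q.2| ≤ ε i)
    {a c : ι → K} {b e : ι → K'} {a₀ c₀ : K} {b₀ e₀ : K'}
    (hab : ∀ i, (a i, b i) ∈ C i) (hce : ∀ i, (c i, e i) ∈ C i)
    (ha : Tendsto a l (𝓝 a₀)) (hb : Tendsto b l (𝓝 b₀))
    (hc : Tendsto c l (𝓝 c₀)) (he : Tendsto e l (𝓝 e₀)) :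
    dist a₀ c₀ = dist b₀ e₀ := by
  have hlim := ((ha.dist hc).sub (hb.dist he)).abs
  have hle := le_of_tendsto_of_tendsto' hlim hε fun i => hC i _ (hab i) _ (hce i)
  exact sub_eq_zero.mp (abs_nonpos_iff.mp hle)


/-- Let `K`, `K'` be compact metric spaces carrying continuous paths `X`, `X'` indexed by
`[0,1]`. If for every `ε > 0` there is a correspondence `ℭ` between `K` and `K'` containing
`(X_t, X'_t)` for all `t` and of distortion at most `ε`, then there is a surjective isometry
`ψ : K → K'` with `X' = ψ ∘ X`. -/
theorem path_preserving_isometry_of_correspondences {K K' : Type*}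
    [MetricSpace K] [MetricSpace K'] [CompactSpace K] [CompactSpace K']
    (X : Set.Icc (0 : ℝ) 1 → K) (X' : Set.Icc (0 : ℝ) 1 → K')
    (hX : Continuous X) (hX' : Continuous X')
    (h : ∀ ε : ℝ, 0 < ε → ∃ C : Set (K × K'),
      (∀ a : K, ∃ b : K', (a, b) ∈ C) ∧
      (∀ b : K', ∃ a : K, (a, b) ∈ C) ∧
      (∀ t : Set.Icc (0 : ℝ) 1, (X t, X' t) ∈ C) ∧
      (∀ p ∈ C, ∀ q ∈ C, |dist p.1 q.1 - dist p.2 q.2| ≤ ε)) :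
    ∃ ψ : K → K', Isometry ψ ∧ Function.Surjective ψ ∧
      ∀ t : Set.Icc (0 : ℝ) 1, X' t = ψ (X t) := by
  choose C hl hr hXC hC using fun n : ℕ => h (1 / ((n : ℝ) + 1)) Nat.one_div_pos_of_nat
  choose f hf using hl
  choose g hg using hr
  let U : Ultrafilter ℕ := Filter.hyperfilter ℕ
  have hε : Filter.Tendsto (fun n : ℕ => 1 / ((n : ℝ) + 1)) U (nhds 0) :=
    tendsto_one_div_add_atTop_nhds_zero_nat.mono_left Nat.hyperfilter_le_atTop
  choose ψ hψ using fun a => exists_tendsto_ultrafilter_of_compactSpace U fun n => f n a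
  choose φ hφ using fun b => exists_tendsto_ultrafilter_of_compactSpace U fun n => g n b
  refine ⟨ψ, Isometry.of_dist_eq fun a c => ?_, fun b => ⟨φ b, ?_⟩, fun t => ?_⟩
  · exact (dist_eq_dist_of_tendsto_of_distortion hε hC (fun n => hf n a) (fun n => hf n c)
      tendsto_const_nhds (hψ a) tendsto_const_nhds (hψ c)).symm
  · have hd := dist_eq_dist_of_tendsto_of_distortion hε hC (fun n => hf n (φ b))
      (fun n => hg n b) tendsto_const_nhds (hψ (φ b)) (hφ b) tendsto_const_nhds
    exact dist_eq_zero.mp (hd.symm.trans (dist_self _))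
  · have hd := dist_eq_dist_of_tendsto_of_distortion hε hC (fun n => hXC n t)
      (fun n => hf n (X t)) tendsto_const_nhds tendsto_const_nhds tendsto_const_nhds (hψ (X t))
    exact dist_eq_zero.mp (hd.symm.trans (dist_self _))
end

section
/- The glued distance can be computed using only chains whose intermediate linking points lie in the glued set W: for all x, y ∈ T, D(x,y) = inf{ Σ_{i=1}^k d(x_i, y_i) : k ≥ 1, x_1 = x, y_k = y, y_i ∼ x_{i+1} for 1 ≤ i ≤ k−1, and moreover y_i ∈ W and x_{i+1} ∈ W for every 1 ≤ i ≤ k−1 }. -/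
theorem eq_or_mem_glueSet_of_glueEquiv {T : Type*} {J : ℕ} {u v : Fin J → T} {a b : T}
    (h : glueEquiv u v a b) : a = b ∨ (a ∈ glueSet u v ∧ b ∈ glueSet u v) := by
  induction h with
  | rel a b h =>
    obtain ⟨i, rfl, rfl⟩ := h
    exact Or.inr ⟨Or.inl ⟨i, rfl⟩, Or.inr ⟨i, rfl⟩⟩
  | refl a => exact Or.inl rfl
  | symm a b _ ih => exact ih.imp Eq.symm And.symm
  | trans a b c _ _ ih₁ ih₂ =>
    rcases ih₁ with rfl | ⟨ha, hb⟩
    · exact ih₂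
    · rcases ih₂ with rfl | ⟨_, hc⟩
      · exact Or.inr ⟨ha, hb⟩
      · exact Or.inr ⟨ha, hc⟩

/-- Every chain can be replaced by a chain that is no longer and links only through `glueSet`. -/
theorem exists_chain_in_glueSet_sum_le {T : Type*} [MetricSpace T] {J : ℕ} (u v : Fin J → T)
    (k : ℕ) (xs ys : Fin (k + 1) → T)
    (hlink : ∀ i : Fin k, glueEquiv u v (ys i.castSucc) (xs i.succ)) :
    ∃ (m : ℕ) (xs' ys' : Fin (m + 1) → T),
      xs' 0 = xs 0 ∧ ys' (Fin.last m) = ys (Fin.last k) ∧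
      (∀ i : Fin m, glueEquiv u v (ys' i.castSucc) (xs' i.succ)) ∧
      (∀ i : Fin m, ys' i.castSucc ∈ glueSet u v ∧ xs' i.succ ∈ glueSet u v) ∧
      ∑ i, dist (xs' i) (ys' i) ≤ ∑ i, dist (xs i) (ys i) := by
  induction k with
  | zero => exact ⟨0, xs, ys, rfl, rfl, hlink, fun i => i.elim0, le_rfl⟩
  | succ k ih =>
    obtain ⟨m, xs', ys', h0, hlast, hequiv, hmem, hsum⟩ :=
      ih (fun i => xs i.succ) (fun i => ys i.succ) fun i => hlink i.succ
    have hfirst : glueEquiv u v (ys 0) (xs' 0) := by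
      rw [h0]
      exact hlink 0
    rw [Fin.sum_univ_succ (fun i => dist (xs i) (ys i))]
    rcases eq_or_mem_glueSet_of_glueEquiv hfirst with heq | hW
    · refine ⟨m, Fin.cons (xs 0) (fun i => xs' i.succ), ys', rfl, hlast, hequiv, hmem, ?_⟩
      rw [Fin.sum_univ_succ] at hsum ⊢
      simp only [Fin.cons_zero, Fin.cons_succ]
      have htri := dist_triangle (xs 0) (ys 0) (ys' 0)
      rw [← heq] at hsum
      linarith
    · refine ⟨m + 1, Fin.cons (xs 0) xs', Fin.cons (ys 0) ys', rfl, hlast, ?_, ?_, ?_⟩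
      · exact Fin.cases hfirst hequiv
      · exact Fin.cases hW hmem
      · rw [Fin.sum_univ_succ]
        simpa only [Fin.cons_zero, Fin.cons_succ, add_le_add_iff_left] using hsum

/-- The glued distance can be computed using only chains whose intermediate linking points lie
in the glued set `W`. -/
theorem glueDist_eq_inf_over_chains_in_glueSet {T : Type*} [MetricSpace T] {J : ℕ}
    (u v : Fin J → T) (x y : T) :
    glueDist u v x y =
      sInf { s : ℝ | ∃ (k : ℕ) (xs ys : Fin (k + 1) → T),
        xs 0 = x ∧ ys (Fin.last k) = y ∧
        (∀ i : Fin k, glueEquiv u v (ys i.castSucc) (xs i.succ)) ∧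
        (∀ i : Fin k, ys i.castSucc ∈ glueSet u v ∧ xs i.succ ∈ glueSet u v) ∧
        s = ∑ i, dist (xs i) (ys i) } := by
  apply le_antisymm
  · refine csInf_le_csInf ⟨0, ?_⟩ ⟨dist x y, 0, fun _ => x, fun _ => y, rfl, rfl,
      fun i => i.elim0, fun i => i.elim0, by simp⟩ ?_
    · rintro s ⟨k, xs, ys, -, -, -, rfl⟩
      positivity
    · rintro s ⟨k, xs, ys, hx, hy, hequiv, -, hs⟩
      exact ⟨k, xs, ys, hx, hy, hequiv, hs⟩
  · refine le_csInf ⟨dist x y, 0, fun _ => x, fun _ => y, rfl, rfl, fun i => i.elim0, by simp⟩ ?_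
    rintro s ⟨k, xs, ys, rfl, rfl, hequiv, rfl⟩
    obtain ⟨m, xs', ys', h0, hlast, hequiv', hmem, hsum⟩ :=
      exists_chain_in_glueSet_sum_le u v k xs ys hequiv
    refine csInf_le_of_le ⟨0, ?_⟩ ⟨m, xs', ys', h0, hlast, hequiv', hmem, rfl⟩ hsum
    rintro s ⟨k, xs, ys, -, -, -, -, rfl⟩
    positivity
end

section
/- The expected number of visits to y before the first return to x equals the ratio of degrees: E_x[N] = deg(y) / deg(x). -/
open MeasureTheory Finset ENNReal

section Markov

variable {V : Type*} [Fintype V] [DecidableEq V] [MeasurableSpace V] [DiscreteMeasurableSpace V]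
  {G : SimpleGraph V} [DecidableRel G.Adj] {x : V} {P : Measure (ℕ → V)}

/-- The trajectories that avoid `x` at the times `1, …, n`. -/
def avoidSet (x : V) (n : ℕ) : Set (ℕ → V) := { ω | ∀ i, 1 ≤ i → i ≤ n → ω i ≠ x }

omit [Fintype V] [DecidableEq V] in
lemma measurableSet_coord_eq (n : ℕ) (v : V) : MeasurableSet { ω : ℕ → V | ω n = v } := by
  have h : Measurable fun ω : ℕ → V => ω n := measurable_pi_apply n
  exact h (measurableSet_singleton v)

omit [Fintype V] [DecidableEq V] in
lemma measurableSet_avoidSet (x : V) (n : ℕ) : MeasurableSet (avoidSet x n) := by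
  have : avoidSet x n = ⋂ i, ⋂ (_ : 1 ≤ i), ⋂ (_ : i ≤ n), { ω : ℕ → V | ω i = x }ᶜ := by
    ext ω; simp [avoidSet]
  rw [this]
  exact MeasurableSet.iInter fun i => MeasurableSet.iInter fun _ => MeasurableSet.iInter fun _ =>
    (measurableSet_coord_eq i x).compl

/-- The Markov property, for an event `s` determined by the first `n + 1` coordinates. -/
lemma measure_inter_coord_succ
    (hP : ∀ (n : ℕ) (tr : ℕ → V),
      P { ω | ∀ i ≤ n, ω i = tr i } =
        if tr 0 = x then ∏ i ∈ Finset.range n, srwStep G (tr i) (tr (i + 1)) else 0)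
    (n : ℕ) (s : Set (ℕ → V))
    (hs : ∀ ω ω' : ℕ → V, (∀ i ≤ n, ω i = ω' i) → ω ∈ s → ω' ∈ s) (w : V) :
    P (s ∩ { ω | ω (n + 1) = w }) = ∑ v, P (s ∩ { ω | ω n = v }) * srwStep G v w := by
  let r : (ℕ → V) → (Fin (n + 1) → V) := fun ω i => ω i
  have hr : ∀ t, MeasurableSet (r ⁻¹' {t}) := by
    intro t
    have : r ⁻¹' {t} = ⋂ i : Fin (n + 1), { ω | ω i = t i } := by
      ext ω; simp [r, funext_iff]
    rw [this]
    exact MeasurableSet.iInter fun i => measurableSet_coord_eq _ _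
  have key : ∀ A : Set (ℕ → V), P A = ∑ t, P (r ⁻¹' {t} ∩ A) := by
    intro A
    have h := sum_measure_preimage_singleton (μ := P.restrict A) (f := r) Finset.univ
      (fun t _ => hr t)
    simp only [Measure.restrict_apply (hr _)] at h
    simp [h]
  rw [key]
  simp_rw [key (s ∩ { ω | ω n = _ }), Finset.sum_mul]
  rw [Finset.sum_comm]
  refine Finset.sum_congr rfl fun t _ => ?_
  by_cases hne : ∃ ω₀, ω₀ ∈ s ∧ r ω₀ = t
  · obtain ⟨ω₀, h₀, rfl⟩ := hne
    have hmem : ∀ ω, r ω = r ω₀ ↔ ∀ i ≤ n, ω i = ω₀ i := by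
      intro ω
      simp only [r, funext_iff, Fin.forall_iff, Nat.lt_succ_iff]
    have hsub : ∀ ω, r ω = r ω₀ → ω ∈ s := fun ω h =>
      hs ω₀ ω (fun i hi => ((hmem ω).1 h i hi).symm) h₀
    have e1 : r ⁻¹' {r ω₀} ∩ (s ∩ { ω | ω (n + 1) = w }) =
        { ω | ∀ i ≤ n + 1, ω i = Function.update ω₀ (n + 1) w i } := by
      ext ω
      simp only [Set.mem_inter_iff, Set.mem_preimage, Set.mem_singleton_iff, Set.mem_ofPred_eq]
      constructor
      · rintro ⟨h1, -, h3⟩ i hi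
        rcases Nat.lt_or_eq_of_le hi with hi | rfl
        · rw [Function.update_of_ne hi.ne]
          exact (hmem ω).1 h1 i (by omega)
        · simpa using h3
      · intro h
        have h1 : r ω = r ω₀ := (hmem ω).2 fun i hi => by
          rw [h i (by omega), Function.update_of_ne (by omega)]
        exact ⟨h1, hsub ω h1, by simpa using h (n + 1) le_rfl⟩
    have e2 : r ⁻¹' {r ω₀} ∩ (s ∩ { ω | ω n = ω₀ n }) = { ω | ∀ i ≤ n, ω i = ω₀ i } := by
      ext ω
      simp only [Set.mem_inter_iff, Set.mem_preimage, Set.mem_singleton_iff, Set.mem_ofPred_eq,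
        ← hmem]
      exact ⟨fun h => h.1, fun h => ⟨h, hsub ω h, (hmem ω).1 h n le_rfl⟩⟩
    rw [Finset.sum_eq_single (ω₀ n), e1, e2, hP, hP, Finset.prod_range_succ]
    · have hprod : ∏ i ∈ Finset.range n, srwStep G (Function.update ω₀ (n + 1) w i)
            (Function.update ω₀ (n + 1) w (i + 1)) =
          ∏ i ∈ Finset.range n, srwStep G (ω₀ i) (ω₀ (i + 1)) := by
        refine Finset.prod_congr rfl fun i hi => ?_
        have := Finset.mem_range.1 hi
        rw [Function.update_of_ne (by omega), Function.update_of_ne (by omega)]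
      rw [hprod, Function.update_of_ne (by omega), Function.update_of_ne (by omega),
        Function.update_self, ite_mul, zero_mul]
    · intro v _ hv
      have : r ⁻¹' {r ω₀} ∩ (s ∩ { ω | ω n = v }) = ∅ := by
        ext ω
        simp only [Set.mem_inter_iff, Set.mem_preimage, Set.mem_singleton_iff, Set.mem_ofPred_eq,
          Set.mem_empty_iff_false, iff_false, not_and]
        intro h _ h'
        exact hv (h' ▸ (hmem ω).1 h n le_rfl)
      rw [this, measure_empty, zero_mul]
    · simp
  · have hempty : ∀ A, r ⁻¹' {t} ∩ (s ∩ A) = ∅ := by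
      intro A
      ext ω
      simp only [Set.mem_inter_iff, Set.mem_preimage, Set.mem_singleton_iff,
          Set.mem_empty_iff_false, iff_false, not_and]
      intro h h'
      exact absurd ⟨ω, h', h⟩ hne
    simp [hempty]

lemma measure_avoidSet_inter_coord_succ
    (hP : ∀ (n : ℕ) (tr : ℕ → V),
      P { ω | ∀ i ≤ n, ω i = tr i } =
        if tr 0 = x then ∏ i ∈ Finset.range n, srwStep G (tr i) (tr (i + 1)) else 0)
    (n : ℕ) (w : V) :
    P (avoidSet x n ∩ { ω | ω (n + 1) = w }) =
      ∑ v, P (avoidSet x n ∩ { ω | ω n = v }) * srwStep G v w :=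
  measure_inter_coord_succ hP n (avoidSet x n) (fun _ _ h hω i hi hin => h i hin ▸ hω i hi hin) w

/-- The expected number of visits to `v` at times `n ≥ 0` such that the walk has not yet returned
to `x` by time `n`. -/
noncomputable def greenBeforeReturn (P : Measure (ℕ → V)) (x v : V) : ℝ≥0∞ :=
  ∑' n, P (avoidSet x n ∩ { ω | ω n = v })

omit [DiscreteMeasurableSpace V] in
lemma measure_coord_zero
    (hP : ∀ (n : ℕ) (tr : ℕ → V),
      P { ω | ∀ i ≤ n, ω i = tr i } =
        if tr 0 = x then ∏ i ∈ Finset.range n, srwStep G (tr i) (tr (i + 1)) else 0)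
    (v : V) : P (avoidSet x 0 ∩ { ω | ω 0 = v }) = if v = x then 1 else 0 := by
  have h := hP 0 (fun _ => v)
  have e : avoidSet x 0 ∩ { ω | ω 0 = v } = { ω | ∀ i ≤ 0, ω i = v } := by
    ext ω
    simp only [avoidSet, Set.mem_inter_iff, Set.mem_ofPred_eq, Nat.le_zero, forall_eq,
      and_iff_right_iff_imp]
    intro _ i h1 h2
    omega
  rw [e, h]
  simp

omit [DiscreteMeasurableSpace V] in
lemma greenBeforeReturn_self
    (hP : ∀ (n : ℕ) (tr : ℕ → V),
      P { ω | ∀ i ≤ n, ω i = tr i } =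
        if tr 0 = x then ∏ i ∈ Finset.range n, srwStep G (tr i) (tr (i + 1)) else 0) :
    greenBeforeReturn P x x = 1 := by
  rw [greenBeforeReturn, tsum_eq_zero_add' ENNReal.summable, measure_coord_zero hP]
  have : ∀ n, avoidSet x (n + 1) ∩ { ω | ω (n + 1) = x } = ∅ := by
    intro n
    ext ω
    simp only [avoidSet, Set.mem_inter_iff, Set.mem_ofPred_eq, Set.mem_empty_iff_false, iff_false,
      not_and]
    exact fun h => h (n + 1) (by omega) le_rfl
  simp [this]

lemma tsum_measure_avoidSet_inter_coord_succ
    (hP : ∀ (n : ℕ) (tr : ℕ → V),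
      P { ω | ∀ i ≤ n, ω i = tr i } =
        if tr 0 = x then ∏ i ∈ Finset.range n, srwStep G (tr i) (tr (i + 1)) else 0)
    (w : V) : ∑' n, P (avoidSet x n ∩ { ω | ω (n + 1) = w }) =
      ∑ v, greenBeforeReturn P x v * srwStep G v w := by
  simp_rw [measure_avoidSet_inter_coord_succ hP, greenBeforeReturn, ← ENNReal.tsum_mul_right]
  exact Summable.tsum_finsetSum fun _ _ => ENNReal.summable

lemma greenBeforeReturn_eq_sum
    (hP : ∀ (n : ℕ) (tr : ℕ → V),
      P { ω | ∀ i ≤ n, ω i = tr i } =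
        if tr 0 = x then ∏ i ∈ Finset.range n, srwStep G (tr i) (tr (i + 1)) else 0)
    {w : V} (hw : w ≠ x) :
    greenBeforeReturn P x w = ∑ v, greenBeforeReturn P x v * srwStep G v w := by
  rw [← tsum_measure_avoidSet_inter_coord_succ hP, greenBeforeReturn,
    tsum_eq_zero_add' ENNReal.summable, measure_coord_zero hP, if_neg hw, zero_add]
  refine tsum_congr fun n => congrArg P ?_
  ext ω
  simp only [avoidSet, Set.mem_inter_iff, Set.mem_ofPred_eq]
  constructor
  · rintro ⟨h, h'⟩
    exact ⟨fun i h1 h2 => h i h1 (by omega), h'⟩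
  · rintro ⟨h, h'⟩
    refine ⟨fun i h1 h2 => ?_, h'⟩
    rcases Nat.lt_or_eq_of_le h2 with h2 | rfl
    · exact h i h1 (by omega)
    · rwa [h']

lemma sum_greenBeforeReturn_mul_srwStep_le_one [IsProbabilityMeasure P]
    (hP : ∀ (n : ℕ) (tr : ℕ → V),
      P { ω | ∀ i ≤ n, ω i = tr i } =
        if tr 0 = x then ∏ i ∈ Finset.range n, srwStep G (tr i) (tr (i + 1)) else 0) :
    ∑ v, greenBeforeReturn P x v * srwStep G v x ≤ 1 := by
  rw [← tsum_measure_avoidSet_inter_coord_succ hP, ← measure_iUnion]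
  · exact prob_le_one
  · refine (symm_disjoint.comap _).pairwise_on _ |>.2 fun m n hmn => ?_
    refine Set.disjoint_left.2 fun ω hm hn => ?_
    exact hn.1 (m + 1) (by omega) (by omega) hm.2
  · exact fun n => (measurableSet_avoidSet x n).inter (measurableSet_coord_eq _ _)

lemma greenBeforeReturn_ne_top [IsProbabilityMeasure P] (hG : G.Connected)
    (hP : ∀ (n : ℕ) (tr : ℕ → V),
      P { ω | ∀ i ≤ n, ω i = tr i } =
        if tr 0 = x then ∏ i ∈ Finset.range n, srwStep G (tr i) (tr (i + 1)) else 0)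
    (v : V) : greenBeforeReturn P x v ≠ ∞ := by
  have hstep : ∀ w u, G.Adj w u → greenBeforeReturn P x w ≠ ∞ →
      greenBeforeReturn P x u ≠ ∞ := by
    intro w u hwu hw
    have hsum : ∑ v, greenBeforeReturn P x v * srwStep G v w ≠ ∞ := by
      by_cases hwx : w = x
      · subst hwx
        exact ((sum_greenBeforeReturn_mul_srwStep_le_one hP).trans_lt one_lt_top).ne
      · rwa [← greenBeforeReturn_eq_sum hP hwx]
    have hu := ENNReal.sum_ne_top.1 hsum u (Finset.mem_univ u)
    intro htop
    rw [htop, srwStep, if_pos hwu.symm, ENNReal.top_mul (by simp)] at hu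
    exact hu rfl
  have hwalk : ∀ a b, G.Walk a b → greenBeforeReturn P x a ≠ ∞ → greenBeforeReturn P x b ≠ ∞ := by
    intro a b p
    induction p with
    | nil => exact id
    | cons h _ ih => exact fun ha => ih (hstep _ _ h ha)
  obtain ⟨p⟩ := hG.preconnected x v
  exact hwalk x v p (by simp [greenBeforeReturn_self hP])

end Markov

/-- The maximum principle: a function harmonic off `x` is maximal at `x`. -/
lemma le_of_harmonic_off {V : Type*} [Fintype V] {G : SimpleGraph V} [DecidableRel G.Adj]
    (hG : G.Connected) (x : V) (g : V → ℝ)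
    (hg : ∀ w, w ≠ x → G.degree w * g w = ∑ v ∈ G.neighborFinset w, g v) (w : V) :
    g w ≤ g x := by
  obtain ⟨m, -, hm⟩ := Finset.exists_max_image Finset.univ g ⟨x, Finset.mem_univ x⟩
  have hwalk : ∀ a b, G.Walk a b → b = x → g a = g m → g x = g m := by
    intro a b p hb
    induction p with
    | nil => subst hb; exact id
    | @cons a c _ h _ ih =>
      intro ha
      by_cases hax : a = x
      · rwa [← hax]
      refine ih hb ?_
      have hzero : ∑ v ∈ G.neighborFinset a, (g m - g v) = 0 := by
        rw [Finset.sum_sub_distrib, ← hg a hax, ha]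
        simp
      have := (Finset.sum_eq_zero_iff_of_nonneg fun v _ =>
        sub_nonneg.2 (hm v (Finset.mem_univ v))).1 hzero c (by simpa using h)
      linarith
  obtain ⟨p⟩ := hG.preconnected m x
  rw [hwalk m x p rfl rfl]
  exact hm w (Finset.mem_univ w)

lemma eq_of_harmonic_off {V : Type*} [Fintype V] {G : SimpleGraph V} [DecidableRel G.Adj]
    (hG : G.Connected) (x : V) (g : V → ℝ)
    (hg : ∀ w, w ≠ x → G.degree w * g w = ∑ v ∈ G.neighborFinset w, g v) (w : V) :
    g w = g x := by
  refine le_antisymm (le_of_harmonic_off hG x g hg w) ?_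
  have := le_of_harmonic_off hG x (fun v => -g v) (fun w hw => by simp [← hg w hw]) w
  linarith

section Visits

variable {V : Type*} [Fintype V] [DecidableEq V] [MeasurableSpace V] [DiscreteMeasurableSpace V]
  {G : SimpleGraph V} [DecidableRel G.Adj] {x y : V} {P : Measure (ℕ → V)}
  [IsProbabilityMeasure P]

lemma toReal_greenBeforeReturn (hG : G.Connected) (hxy : x ≠ y)
    (hP : ∀ (n : ℕ) (tr : ℕ → V),
      P { ω | ∀ i ≤ n, ω i = tr i } =
        if tr 0 = x then ∏ i ∈ Finset.range n, srwStep G (tr i) (tr (i + 1)) else 0) :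
    (greenBeforeReturn P x y).toReal = (G.degree y : ℝ) / (G.degree x : ℝ) := by
  have : Nontrivial V := ⟨x, y, hxy⟩
  have hdeg : ∀ v, (G.degree v : ℝ) ≠ 0 := fun v =>
    Nat.cast_ne_zero.2 (hG.preconnected.degree_pos_of_nontrivial v).ne'
  have h := eq_of_harmonic_off hG x (fun v => (greenBeforeReturn P x v).toReal / G.degree v) ?_ y
  · simp only [greenBeforeReturn_self hP, ENNReal.toReal_one] at h
    have := hdeg x
    have := hdeg y
    field_simp at h ⊢
    linarith
  · intro w hw
    rw [mul_div_cancel₀ _ (hdeg w), greenBeforeReturn_eq_sum hP hw, ENNReal.toReal_sum]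
    · rw [← Finset.sum_subset (Finset.subset_univ (G.neighborFinset w))]
      · refine Finset.sum_congr rfl fun v hv => ?_
        have hv : G.Adj v w := ((G.mem_neighborFinset w v).1 hv).symm
        simp [srwStep, hv, div_eq_mul_inv]
      · intro v _ hv
        have hv : ¬ G.Adj v w := fun h => hv ((G.mem_neighborFinset w v).2 h.symm)
        simp [srwStep, hv]
    · intro v _
      refine ENNReal.mul_ne_top (greenBeforeReturn_ne_top hG hP v) ?_
      rw [srwStep]
      split_ifs
      · exact ENNReal.inv_ne_top.2 (Nat.cast_ne_zero.2
          (hG.preconnected.degree_pos_of_nontrivial v).ne')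
      · exact ENNReal.zero_ne_top

lemma ae_exists_return (hG : G.Connected)
    (hP : ∀ (n : ℕ) (tr : ℕ → V),
      P { ω | ∀ i ≤ n, ω i = tr i } =
        if tr 0 = x then ∏ i ∈ Finset.range n, srwStep G (tr i) (tr (i + 1)) else 0) :
    ∀ᵐ ω ∂P, ∃ n, 1 ≤ n ∧ ω n = x := by
  have hlim : Filter.Tendsto (fun n => ∑ v, P (avoidSet x n ∩ { ω | ω n = v })) Filter.atTop
      (nhds 0) := by
    have := tendsto_finsetSum (Finset.univ : Finset V) fun v _ =>
      ENNReal.tendsto_atTop_zero_of_tsum_ne_top (greenBeforeReturn_ne_top hG hP v)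
    simpa using this
  refine le_antisymm (ge_of_tendsto' hlim fun n => ?_) zero_le
  refine (measure_mono fun ω hω => ?_).trans (measure_iUnion_fintype_le P _)
  simp only [Set.mem_compl_iff, Set.mem_ofPred_eq, not_exists, not_and] at hω
  exact Set.mem_iUnion.2 ⟨ω n, fun i hi _ => hω i hi, rfl⟩

omit [Fintype V] [MeasurableSpace V] [DiscreteMeasurableSpace V] [IsProbabilityMeasure P] in
lemma lt_firstReturn_iff {ω : ℕ → V} (h : ∃ n, 1 ≤ n ∧ ω n = x) (n : ℕ) :
    n < firstReturn x ω ↔ ω ∈ avoidSet x n := by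
  have hmem : firstReturn x ω ∈ { n : ℕ | 1 ≤ n ∧ ω n = x } := Nat.sInf_mem h
  constructor
  · intro hn i hi hin hx
    exact absurd (Nat.sInf_le (show i ∈ { n : ℕ | 1 ≤ n ∧ ω n = x } from ⟨hi, hx⟩))
      (not_le.2 (hin.trans_lt hn))
  · intro hω
    by_contra hn
    exact hω _ hmem.1 (not_lt.1 hn) hmem.2

omit [Fintype V] [MeasurableSpace V] [DiscreteMeasurableSpace V] [IsProbabilityMeasure P] in
lemma natCast_visitsBeforeReturn {ω : ℕ → V} (h : ∃ n, 1 ≤ n ∧ ω n = x) (h0 : ω 0 ≠ y) :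
    (visitsBeforeReturn x y ω : ℝ≥0∞) =
      ∑' n, (avoidSet x n ∩ { ω | ω n = y }).indicator 1 ω := by
  rw [visitsBeforeReturn, Finset.card_filter, Nat.cast_sum,
    tsum_eq_sum (s := Finset.range (firstReturn x ω))]
  · refine Finset.sum_congr rfl fun n hn => ?_
    have hω := (lt_firstReturn_iff h n).1 (Finset.mem_range.1 hn)
    have hn : ω n = y → 1 ≤ n := fun hy => Nat.one_le_iff_ne_zero.2 fun hn => h0 (hn ▸ hy)
    by_cases hy : ω n = y <;> simp [Set.indicator, hω, hy, hn]
  · intro n hn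
    have hω := mt (lt_firstReturn_iff h n).2 (mt Finset.mem_range.2 hn)
    simp [Set.indicator, hω]

end Visits

/-- For the simple random walk on a finite connected graph started at `x`, the expected number
of visits to `y ≠ x` before the first return to `x` equals `deg(y) / deg(x)`. The law `P` of
the walk is characterized by its cylinder probabilities. -/
theorem expected_visits_before_return {V : Type*} [Fintype V] [DecidableEq V]
    [MeasurableSpace V] [DiscreteMeasurableSpace V]
    (G : SimpleGraph V) [DecidableRel G.Adj] (hG : G.Connected)
    (x y : V) (hxy : x ≠ y)
    (P : Measure (ℕ → V)) [IsProbabilityMeasure P]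
    (hP : ∀ (n : ℕ) (tr : ℕ → V),
      P { ω | ∀ i ≤ n, ω i = tr i } =
        if tr 0 = x then ∏ i ∈ Finset.range n, srwStep G (tr i) (tr (i + 1)) else 0) :
    ∫ ω, (visitsBeforeReturn x y ω : ℝ) ∂P = (G.degree y : ℝ) / (G.degree x : ℝ) := by
  have hae : ∀ᵐ ω ∂P, (visitsBeforeReturn x y ω : ℝ≥0∞) =
      ∑' n, (avoidSet x n ∩ { ω | ω n = y }).indicator 1 ω := by
    have h0 : ∀ᵐ ω ∂P, ω 0 ≠ y := by
      have h := measure_coord_zero hP y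
      rw [if_neg hxy.symm] at h
      rw [ae_iff]
      refine measure_mono_null (fun ω hω => ?_) h
      exact ⟨fun i h1 h2 => by omega, by simpa using hω⟩
    filter_upwards [ae_exists_return hG hP, h0] with ω h h0
    exact natCast_visitsBeforeReturn h h0
  have hmeas : ∀ n, MeasurableSet (avoidSet x n ∩ { ω : ℕ → V | ω n = y }) := fun n =>
    (measurableSet_avoidSet x n).inter (measurableSet_coord_eq n y)
  have hind : ∀ n, Measurable ((avoidSet x n ∩ { ω : ℕ → V | ω n = y }).indicator
      (1 : (ℕ → V) → ℝ≥0∞)) := fun n => measurable_one.indicator (hmeas n)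
  rw [← toReal_greenBeforeReturn hG hxy hP, greenBeforeReturn]
  simp_rw [← fun n => lintegral_indicator_one (μ := P) (hmeas n)]
  rw [← lintegral_tsum fun n => (hind n).aemeasurable, ← integral_toReal]
  · refine integral_congr_ae (hae.mono fun ω hω => ?_)
    simp only [← hω, ENNReal.toReal_natCast]
  · exact (Measurable.tsum hind).aemeasurable
  · filter_upwards [hae] with ω hω
    rw [← hω]
    exact ENNReal.natCast_lt_top _
end
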